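/- Let G ∈ 𝒢_c with host tree T such that G is isomorphic to neither G₂ nor G₄, and let X ⊆ D_T′ ∪ {u ∈ V(G) : deg_G(u) = 2}. If |X| = 3 and no vertex in V(G) \ X has 3 neighbors in X, then ν_ur(G − X) = ν_ur(G), where G − X is the subgraph of G induced on V(G) \ X. -/

import Mathlib

open SimpleGraph

namespace URPaper

/-- `M` is a matching in the simple graph `G`: a finite set of edges of `G`
that are pairwise vertex-disjoint. -/
def IsMatchingSet {V : Type*} (G : SimpleGraph V) (M : Finset (Sym2 V)) : Prop :=
  (∀ e ∈ M, e ∈ G.edgeSet) ∧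
    ∀ e ∈ M, ∀ f ∈ M, e ≠ f → ∀ v : V, v ∈ e → v ∉ f

/-- The set of vertices covered by a set of edges. -/
def covered {V : Type*} (M : Finset (Sym2 V)) : Set V := {v | ∃ e ∈ M, v ∈ e}

/-- A matching `M` in `G` is uniquely restricted if no other matching of `G`
covers exactly the same set of vertices. -/
def IsURMatching {V : Type*} (G : SimpleGraph V) (M : Finset (Sym2 V)) : Prop :=
  IsMatchingSet G M ∧
    ∀ M' : Finset (Sym2 V), IsMatchingSet G M' → covered M' = covered M → M' = M

/-- The matching number `ν(G)`: the maximum size of a matching in `G`. -/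
noncomputable def nu {V : Type*} (G : SimpleGraph V) : ℕ :=
  sSup {k | ∃ M : Finset (Sym2 V), IsMatchingSet G M ∧ M.card = k}

/-- The uniquely restricted matching number `ν_ur(G)`: the maximum size of a
uniquely restricted matching in `G`. -/
noncomputable def nuUR {V : Type*} (G : SimpleGraph V) : ℕ :=
  sSup {k | ∃ M : Finset (Sym2 V), IsURMatching G M ∧ M.card = k}

/-- `D_G`: the set of vertices missed by at least one maximum matching of `G`. -/
def gallaiD {V : Type*} (G : SimpleGraph V) : Set V :=
  {v | ∃ M : Finset (Sym2 V), IsMatchingSet G M ∧ M.card = nu G ∧ v ∉ covered M}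

/-- `A_G`: the set of vertices outside `D_G` having a neighbor in `D_G`. -/
def gallaiA {V : Type*} (G : SimpleGraph V) : Set V :=
  {v | v ∉ gallaiD G ∧ ∃ u ∈ gallaiD G, G.Adj v u}

/-- `C_G = V(G) \ (A_G ∪ D_G)`. -/
def gallaiC {V : Type*} (G : SimpleGraph V) : Set V :=
  {v | v ∉ gallaiD G ∧ v ∉ gallaiA G}

/-- Membership in the family `𝒯`: trees `T` with `ν(T) = (n(T) - 1)/3`
(equivalently `3 ν(T) + 1 = n(T)`) such that every vertex of `A_T` has degree
at most `3` in `T`. -/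
def MemT {V : Type*} (T : SimpleGraph V) : Prop :=
  T.IsTree ∧ (∀ v ∈ gallaiA T, (T.neighborSet v).ncard ≤ 3) ∧
    3 * nu T + 1 = Nat.card V

/-- The graph obtained from `T` by contracting the set `S` to a single new
vertex (the vertex `none`), all other vertices being kept. -/
def contractSet {V : Type*} (T : SimpleGraph V) (S : Set V) :
    SimpleGraph (Option {x : V // x ∉ S}) where
  Adj a b :=
    match a, b with
    | some x, some y => T.Adj x y
    | some x, none => ∃ u ∈ S, T.Adj (x : V) u
    | none, some y => ∃ u ∈ S, T.Adj (y : V) u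
    | none, none => False
  symm := by
    refine ⟨?_⟩
    rintro (_ | x) (_ | y) h
    · exact h
    · exact h
    · exact h
    · exact T.adj_symm h
  loopless := by
    refine ⟨?_⟩
    rintro (_ | x) h
    · exact h
    · exact T.loopless.irrefl _ h

/-- The graph `BG1` from the paper, given by an explicit edge list. -/
def BG1 : SimpleGraph (Fin 10) :=
  SimpleGraph.fromEdgeSet {s(0,4), s(1,4), s(0,5), s(2,5), s(0,6), s(3,6), s(1,7), s(2,7), s(1,8), s(3,8), s(2,9), s(3,9)}

/-- The graph `BG2` from the paper, given by an explicit edge list. -/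
def BG2 : SimpleGraph (Fin 13) :=
  SimpleGraph.fromEdgeSet {s(0,4), s(1,4), s(0,5), s(2,5), s(0,6), s(3,6), s(1,7), s(2,7), s(1,8), s(3,8), s(2,9), s(3,9), s(10,6), s(10,7), s(11,8), s(11,5), s(12,4), s(12,9)}

/-- The graph `BG3` from the paper, given by an explicit edge list. -/
def BG3 : SimpleGraph (Fin 16) :=
  SimpleGraph.fromEdgeSet {s(0,1), s(1,2), s(2,3), s(3,4), s(4,5), s(5,0), s(6,7), s(7,8), s(8,9), s(9,10), s(10,11), s(11,6), s(12,0), s(12,6), s(13,2), s(13,8), s(14,4), s(14,10), s(15,12), s(15,13), s(15,14)}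

/-- The graph `BG4` from the paper, given by an explicit edge list. -/
def BG4 : SimpleGraph (Fin 19) :=
  SimpleGraph.fromEdgeSet {s(0,1), s(1,2), s(2,3), s(3,4), s(4,5), s(5,0), s(6,7), s(7,8), s(8,9), s(9,10), s(10,11), s(11,6), s(12,0), s(13,1), s(14,2), s(15,3), s(16,4), s(17,5), s(12,6), s(13,7), s(14,8), s(15,9), s(16,10), s(17,11), s(18,12), s(18,14), s(18,16)}

/-- The graph `BG5` from the paper, given by an explicit edge list. -/
def BG5 : SimpleGraph (Fin 16) :=
  SimpleGraph.fromEdgeSet {s(0,4), s(1,4), s(0,5), s(2,5), s(0,6), s(3,6), s(1,7), s(2,7), s(1,8), s(3,8), s(2,9), s(3,9), s(10,6), s(10,7), s(11,8), s(11,5), s(12,4), s(12,9), s(13,14), s(14,15), s(13,10), s(13,11), s(15,12)}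

/-- The graph `BG6` from the paper, given by an explicit edge list. -/
def BG6 : SimpleGraph (Fin 19) :=
  SimpleGraph.fromEdgeSet {s(0,4), s(1,4), s(0,5), s(2,5), s(0,6), s(3,6), s(1,7), s(2,7), s(1,8), s(3,8), s(2,9), s(3,9), s(10,6), s(10,7), s(11,8), s(11,5), s(12,4), s(12,9), s(13,14), s(14,15), s(15,16), s(16,17), s(17,18), s(18,13), s(13,10), s(15,11), s(17,12)}

/-- The graph `BG7` from the paper, given by an explicit edge list. -/
def BG7 : SimpleGraph (Fin 19) :=
  SimpleGraph.fromEdgeSet {s(0,1), s(1,2), s(2,3), s(3,4), s(4,5), s(5,0), s(6,7), s(7,8), s(8,9), s(9,10), s(10,11), s(11,6), s(12,0), s(12,6), s(13,2), s(13,8), s(14,4), s(14,10), s(15,12), s(15,13), s(15,14), s(17,16), s(16,18), s(17,9), s(17,5), s(18,3), s(18,11)}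

/-- The graph `BG8` from the paper, given by an explicit edge list. -/
def BG8 : SimpleGraph (Fin 22) :=
  SimpleGraph.fromEdgeSet {s(0,1), s(1,2), s(2,3), s(3,4), s(4,5), s(5,0), s(6,7), s(7,8), s(8,9), s(9,10), s(10,11), s(11,6), s(12,0), s(13,1), s(14,2), s(15,3), s(16,4), s(17,5), s(12,6), s(13,7), s(14,8), s(15,9), s(16,10), s(17,11), s(18,12), s(18,14), s(18,16), s(19,20), s(20,21), s(19,13), s(19,15), s(21,17)}

/-- The graph `BG9` from the paper, given by an explicit edge list. -/
def BG9 : SimpleGraph (Fin 25) :=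
  SimpleGraph.fromEdgeSet {s(0,1), s(1,2), s(2,3), s(3,4), s(4,5), s(5,0), s(6,7), s(7,8), s(8,9), s(9,10), s(10,11), s(11,6), s(12,0), s(13,1), s(14,2), s(15,3), s(16,4), s(17,5), s(12,6), s(13,7), s(14,8), s(15,9), s(16,10), s(17,11), s(18,12), s(18,14), s(18,16), s(19,20), s(20,21), s(21,22), s(22,23), s(23,24), s(24,19), s(19,13), s(21,15), s(23,17)}

/-- The graph `GraphH1` from the paper, given by an explicit edge list. -/
def GraphH1 : SimpleGraph (Fin 14) :=
  SimpleGraph.fromEdgeSet {s(0,4), s(1,4), s(0,5), s(2,5), s(0,6), s(3,6), s(1,7), s(2,7), s(1,8), s(3,8), s(2,9), s(3,9), s(10,6), s(10,7), s(11,8), s(11,5), s(12,4), s(12,9), s(13,10), s(13,11), s(13,12)}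

/-- The graph `GraphH2` from the paper, given by an explicit edge list. -/
def GraphH2 : SimpleGraph (Fin 20) :=
  SimpleGraph.fromEdgeSet {s(0,1), s(1,2), s(2,3), s(3,4), s(4,5), s(5,0), s(6,7), s(7,8), s(8,9), s(9,10), s(10,11), s(11,6), s(12,0), s(13,1), s(14,2), s(15,3), s(16,4), s(17,5), s(12,6), s(13,7), s(14,8), s(15,9), s(16,10), s(17,11), s(18,12), s(18,14), s(18,16), s(19,13), s(19,15), s(19,17)}

/-- Membership in the family `ℬ = {G₁, …, G₉}`, up to isomorphism. -/
def IsBlockB : ∀ (X : Type), SimpleGraph X → Prop := fun _ H =>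
  Nonempty (H ≃g BG1) ∨ Nonempty (H ≃g BG2) ∨ Nonempty (H ≃g BG3) ∨
  Nonempty (H ≃g BG4) ∨ Nonempty (H ≃g BG5) ∨ Nonempty (H ≃g BG6) ∨
  Nonempty (H ≃g BG7) ∨ Nonempty (H ≃g BG8) ∨ Nonempty (H ≃g BG9)

/-- Membership in the family `ℬ_c = {G₁, G₂, G₃, G₄}`, up to isomorphism. -/
def IsBlockBc : ∀ (X : Type), SimpleGraph X → Prop := fun _ H =>
  Nonempty (H ≃g BG1) ∨ Nonempty (H ≃g BG2) ∨ Nonempty (H ≃g BG3) ∨ Nonempty (H ≃g BG4)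

/-- `G` (on vertex set `W`) arises from the tree `T` (on vertex set `V`) by
replacing every vertex of `S` by a graph from the family `𝓑`.  The map `π`
sends every vertex of `G` to the vertex of `T` it corresponds to:
* every fiber over a vertex outside `S` is a single vertex, and on these
  vertices `π` is an isomorphism with the corresponding induced subgraph of `T`;
* the fiber over a vertex `s ∈ S` induces a graph of the family `𝓑`;
* there are no edges between the fibers of two distinct vertices of `S`;
* for `s ∈ S` and `v ∉ S`, there is exactly one edge of `G` between the two
  fibers if `sv ∈ E(T)` and none otherwise;
* each vertex of a fiber over `s ∈ S` has at most one neighbor outside this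
  fiber (distinct attachment vertices), and a vertex of such a fiber having a
  neighbor outside the fiber has exactly two neighbors inside it
  (attachment only at vertices of degree `2` of the replacing graph). -/
def ArisesFrom (𝓑 : ∀ (X : Type), SimpleGraph X → Prop) {W V : Type}
    (G : SimpleGraph W) (T : SimpleGraph V) (S : Set V) (π : W → V) : Prop :=
  Function.Surjective π ∧
  (∀ v ∉ S, ∀ w w' : W, π w = v → π w' = v → w = w') ∧
  (∀ w w' : W, π w ∉ S → π w' ∉ S → (G.Adj w w' ↔ T.Adj (π w) (π w'))) ∧
  (∀ s ∈ S, 𝓑 _ (G.induce (π ⁻¹' {s}))) ∧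
  (∀ s ∈ S, ∀ s' ∈ S, s ≠ s' → ∀ w w' : W, π w = s → π w' = s' → ¬ G.Adj w w') ∧
  (∀ s ∈ S, ∀ v ∉ S, T.Adj s v →
    ∃! p : W × W, π p.1 = s ∧ π p.2 = v ∧ G.Adj p.1 p.2) ∧
  (∀ s ∈ S, ∀ v ∉ S, ¬ T.Adj s v →
    ∀ w w' : W, π w = s → π w' = v → ¬ G.Adj w w') ∧
  (∀ s ∈ S, ∀ w : W, π w = s → ∀ w₁ w₂ : W, π w₁ ≠ s → π w₂ ≠ s →
    G.Adj w w₁ → G.Adj w w₂ → w₁ = w₂) ∧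
  (∀ s ∈ S, ∀ w : W, π w = s → ∀ w' : W, π w' ≠ s → G.Adj w w' →
    (G.neighborSet w ∩ π ⁻¹' {s}).ncard = 2)

/-- Membership in the family `𝒢`: graphs arising from a tree `T ∈ 𝒯` by
replacing each vertex of a subset `S ⊆ D_T` by a graph of the family `ℬ`. -/
def InCalG {W : Type} (G : SimpleGraph W) : Prop :=
  ∃ (V : Type) (T : SimpleGraph V) (S : Set V) (π : W → V),
    Finite V ∧ MemT T ∧ S ⊆ gallaiD T ∧ ArisesFrom IsBlockB G T S π

/-- `κ_G(P)`: the number of connected components of `G` whose induced graph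
satisfies the (isomorphism invariant) predicate `P`. -/
noncomputable def kappa {W : Type} (G : SimpleGraph W)
    (P : ∀ (X : Type), SimpleGraph X → Prop) : ℕ :=
  Nat.card {c : G.ConnectedComponent // P _ (G.induce c.supp)}

/-- Membership in `𝒢₃`: cubic graphs of girth at least `5`. -/
def IsCubicGirth5 : ∀ (X : Type), SimpleGraph X → Prop := fun _ H =>
  (∀ v, (H.neighborSet v).ncard = 3) ∧ 5 ≤ H.egirth

/-- Being isomorphic to `H₁` or `H₂`. -/
def IsH1orH2 : ∀ (X : Type), SimpleGraph X → Prop := fun _ H =>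
  Nonempty (H ≃g GraphH1) ∨ Nonempty (H ≃g GraphH2)

/-- Lemma 9 of the paper. Let `G ∈ 𝒢_c` (all replaced
blocks belong to `ℬ_c`) with host tree `T` (replaced set `S ⊆ D_T`,
projection `π`), such that `G` is isomorphic to neither `G₂` nor `G₄`, and let
`X ⊆ D_T' ∪ {u ∈ V(G) : deg_G(u) = 2}`. If `|X| = 3` and no vertex in
`V(G) \ X` has `3` neighbors in `X`, then `ν_ur(G - X) = ν_ur(G)`. -/

theorem IsMatchingSet.eq_of_mem {V : Type*} {G : SimpleGraph V} {M : Finset (Sym2 V)}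
    (h : IsMatchingSet G M) {e f : Sym2 V} (he : e ∈ M) (hf : f ∈ M) {v : V}
    (hv : v ∈ e) (hv' : v ∈ f) : e = f := by
  by_contra hne
  exact h.2 e he f hf hne v hv hv'

theorem IsMatchingSet.partner {V : Type*} {G : SimpleGraph V} {M : Finset (Sym2 V)}
    (h : IsMatchingSet G M) {a b c : V} (h1 : s(a,b) ∈ M) (h2 : s(a,c) ∈ M) : b = c := by
  have := h.eq_of_mem h1 h2 (v := a) (by simp) (by simp)
  rw [Sym2.eq_iff] at this
  rcases this with h | h
  · exact h.2
  · exact h.2.trans h.1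

/-- lower bound lemma -/
theorem ur_of_rank {U : Type*} [DecidableEq U] {α : Type*} [LinearOrder α] [WellFoundedLT α]
    (H : SimpleGraph U) (P : Set U) (hP : ∀ x y, H.Adj x y → (x ∈ P ↔ y ∉ P))
    (Z : Finset U) (m : U → U) (r : U → α) (hZ : ∀ p ∈ Z, p ∈ P)
    (hm : ∀ p ∈ Z, H.Adj p (m p))
    (hr : ∀ p ∈ Z, ∀ p' ∈ Z, p' ≠ p → H.Adj p' (m p) → r p' < r p) :
    ∃ M, IsURMatching H M ∧ M.card = Z.card := by
  have inj : ∀ p ∈ Z, ∀ p' ∈ Z, m p = m p' → p = p' := by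
    intro p hp p' hp' h
    by_contra hne
    have h1 := hr p hp p' hp' (Ne.symm hne) (h ▸ hm p' hp')
    have h2 := hr p' hp' p hp hne (h ▸ hm p hp)
    exact lt_asymm h1 h2
  have mP : ∀ p ∈ Z, m p ∉ P := fun p hp => ((hP _ _ (hm p hp)).1 (hZ p hp))
  have neZ : ∀ p ∈ Z, ∀ p' ∈ Z, p ≠ m p' := by
    intro p hp p' hp' h
    exact mP p' hp' (h ▸ hZ p hp)
  have hMat : IsMatchingSet H (Z.image fun p => s(p, m p)) := by
    constructor
    · intro e he
      obtain ⟨p, hp, rfl⟩ := Finset.mem_image.1 he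
      exact hm p hp
    · intro e he f hf hne v hv hv'
      obtain ⟨p, hp, rfl⟩ := Finset.mem_image.1 he
      obtain ⟨p', hp', rfl⟩ := Finset.mem_image.1 hf
      have hpp : p ≠ p' := by rintro rfl; exact hne rfl
      rw [Sym2.mem_iff] at hv hv'
      rcases hv with rfl | rfl <;> rcases hv' with h | h
      · exact hpp h
      · exact neZ _ hp _ hp' h
      · exact neZ _ hp' _ hp h.symm
      · exact hpp (inj _ hp _ hp' h)
  refine ⟨Z.image fun p => s(p, m p), ⟨hMat, ?_⟩, ?_⟩
  · intro M' hM' hcov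
    have key : ∀ a : α, ∀ p ∈ Z, r p = a → s(p, m p) ∈ M' := by
      intro a
      induction a using WellFoundedLT.induction with
      | ind a ih =>
      intro p hp hpa
      have hq : m p ∈ covered M' := by
        rw [hcov]
        exact ⟨s(p, m p), Finset.mem_image_of_mem _ hp, by simp⟩
      obtain ⟨e, he, hqe⟩ := hq
      obtain ⟨x, rfl⟩ := hqe
      have hadj : H.Adj (m p) x := hM'.1 _ he
      have hxP : x ∈ P := by
        by_contra hx
        exact mP p hp ((hP _ _ hadj).2 hx)
      have hx : x ∈ covered (Z.image fun p => s(p, m p)) := by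
        rw [← hcov]
        exact ⟨_, he, by simp⟩
      obtain ⟨f, hf, hxf⟩ := hx
      obtain ⟨p', hp', rfl⟩ := Finset.mem_image.1 hf
      rw [Sym2.mem_iff] at hxf
      rcases hxf with rfl | rfl
      · by_cases hxp : x = p
        · subst hxp; rwa [Sym2.eq_swap]
        · exfalso
          have hlt := hr p hp x hp' hxp hadj.symm
          have := ih _ (hpa ▸ hlt) x hp' rfl
          rw [Sym2.eq_swap] at he
          have hh := hM'.partner this he
          exact hxp (inj _ hp' _ hp hh)
      · exact absurd hxP (mP _ hp')
    apply Finset.Subset.antisymm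
    · intro e he
      obtain ⟨v, w⟩ := e
      have hv : v ∈ covered (Z.image fun p => s(p, m p)) := by
        rw [← hcov]; exact ⟨_, he, by simp⟩
      obtain ⟨f, hf, hvf⟩ := hv
      have hf' : f ∈ M' := by
        obtain ⟨p', hp', rfl⟩ := Finset.mem_image.1 hf
        exact key _ p' hp' rfl
      have := hM'.eq_of_mem he hf' (v := v) (by simp) hvf
      rw [this]; exact hf
    · intro f hf
      obtain ⟨p', hp', rfl⟩ := Finset.mem_image.1 hf
      exact key _ p' hp' rfl
  · apply Finset.card_image_of_injOn
    intro p hp p' hp' h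
    simp only [Sym2.eq_iff] at h
    rcases h with h | h
    · exact h.1
    · exact absurd h.1 (neZ _ hp _ hp')

/-- non-uniqueness lemma -/
theorem not_ur_of_stop {U : Type*} (H : SimpleGraph U) (M : Finset (Sym2 U))
    (hM : IsURMatching H M) (Z : Finset U) (hne : Z.Nonempty) (t : U → U)
    (ht : ∀ p ∈ Z, s(p, t p) ∈ M) (htZ : ∀ p ∈ Z, t p ∉ Z)
    (hs : ∀ p ∈ Z, ∃ p' ∈ Z, p' ≠ p ∧ H.Adj p' (t p)) : False := by
  classical
  choose! f hf using hs
  -- minimal closed subset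
  let F := Z.powerset.filter (fun Y => Y.Nonempty ∧ ∀ p ∈ Y, f p ∈ Y)
  have hF : F.Nonempty := ⟨Z, by simp only [F, Finset.mem_filter, Finset.mem_powerset]; exact ⟨le_refl _, hne, fun p hp => (hf p hp).1⟩⟩
  obtain ⟨Y, hYF, hmin⟩ := F.exists_minimal hF
  simp only [F, Finset.mem_filter, Finset.mem_powerset] at hYF
  obtain ⟨hYZ, hYne, hYc⟩ := hYF
  have him : Y.image f = Y := by
    have hsub : Y.image f ⊆ Y := by
      intro x hx; obtain ⟨p, hp, rfl⟩ := Finset.mem_image.1 hx; exact hYc p hp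
    have : Y.image f ∈ F := by
      simp only [F, Finset.mem_filter, Finset.mem_powerset]
      refine ⟨hsub.trans hYZ, hYne.image f, ?_⟩
      intro p hp
      exact Finset.mem_image_of_mem f (hsub hp)
    exact Finset.Subset.antisymm hsub (hmin this hsub)
  have hinj : ∀ p ∈ Y, ∀ p' ∈ Y, f p = f p' → p = p' := by
    have : Set.InjOn f Y := Finset.injOn_of_card_image_eq (by rw [him])
    intro p hp p' hp' h; exact this hp hp' h
  have htinj : ∀ p ∈ Y, ∀ p' ∈ Y, t p = t p' → p = p' := by
    intro p hp p' hp' h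
    have h1 := ht p (hYZ hp); have h2 := ht p' (hYZ hp')
    rw [h, Sym2.eq_swap] at h1; rw [Sym2.eq_swap] at h2
    exact hM.1.partner h1 h2
  let R := Y.image (fun p => s(p, t p))
  let N := Y.image (fun p => s(f p, t p))
  let M' := (M \ R) ∪ N
  have hfY : ∀ p ∈ Y, f p ≠ p := fun p hp => (hf p (hYZ hp)).2.1
  have cross : ∀ e ∈ M \ R, ∀ p ∈ Y, p ∉ e ∧ t p ∉ e := by
    intro e he p hp
    rw [Finset.mem_sdiff] at he
    have hR : s(p, t p) ∈ R := Finset.mem_image_of_mem (fun p => s(p, t p)) hp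
    constructor
    · intro h
      have := hM.1.eq_of_mem he.1 (ht p (hYZ hp)) h (by simp)
      exact he.2 (this ▸ hR)
    · intro h
      have := hM.1.eq_of_mem he.1 (ht p (hYZ hp)) h (by simp)
      exact he.2 (this ▸ hR)
  have cross2 : ∀ e ∈ M \ R, ∀ g ∈ N, ∀ v, v ∈ e → v ∉ g := by
    intro e he g hg v hv hvg
    obtain ⟨p, hp, rfl⟩ := Finset.mem_image.1 hg
    rw [Sym2.mem_iff] at hvg
    rcases hvg with rfl | rfl
    · exact (cross e he _ (hYc p hp)).1 hv
    · exact (cross e he p hp).2 hv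
  have hM' : IsMatchingSet H M' := by
    constructor
    · intro e he
      rcases Finset.mem_union.1 he with he | he
      · exact hM.1.1 e (Finset.mem_sdiff.1 he).1
      · obtain ⟨p, hp, rfl⟩ := Finset.mem_image.1 he
        exact (hf p (hYZ hp)).2.2
    · intro e he g hg heg v hv hvg
      rcases Finset.mem_union.1 he with he | he <;> rcases Finset.mem_union.1 hg with hg | hg
      · exact hM.1.2 e (Finset.mem_sdiff.1 he).1 g (Finset.mem_sdiff.1 hg).1 heg v hv hvg
      · exact cross2 e he g hg v hv hvg
      · exact cross2 g hg e he v hvg hv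
      · obtain ⟨p, hp, rfl⟩ := Finset.mem_image.1 he
        obtain ⟨p', hp', rfl⟩ := Finset.mem_image.1 hg
        have hpp : p ≠ p' := by rintro rfl; exact heg rfl
        rw [Sym2.mem_iff] at hv hvg
        rcases hv with rfl | rfl <;> rcases hvg with h | h
        · exact hpp (hinj _ hp _ hp' h)
        · exact htZ p' (hYZ hp') (h ▸ hYZ (hYc p hp))
        · exact htZ p (hYZ hp) (h ▸ hYZ (hYc p' hp'))
        · exact hpp (htinj _ hp _ hp' h)
  have hcov : covered M' = covered M := by
    ext v
    constructor
    · rintro ⟨e, he, hv⟩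
      rcases Finset.mem_union.1 he with he | he
      · exact ⟨e, (Finset.mem_sdiff.1 he).1, hv⟩
      · obtain ⟨p, hp, rfl⟩ := Finset.mem_image.1 he
        rw [Sym2.mem_iff] at hv
        rcases hv with rfl | rfl
        · exact ⟨_, ht _ (hYZ (hYc p hp)), by simp⟩
        · exact ⟨_, ht p (hYZ hp), by simp⟩
    · rintro ⟨e, he, hv⟩
      by_cases heR : e ∈ R
      · obtain ⟨p, hp, rfl⟩ := Finset.mem_image.1 heR
        rw [Sym2.mem_iff] at hv
        rcases hv with rfl | rfl
        · rw [← him] at hp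
          obtain ⟨p', hp', rfl⟩ := Finset.mem_image.1 hp
          exact ⟨s(f p', t p'), Finset.mem_union_right _ (Finset.mem_image_of_mem (fun p => s(f p, t p)) hp'), by simp⟩
        · exact ⟨s(f p, t p), Finset.mem_union_right _ (Finset.mem_image_of_mem (fun p => s(f p, t p)) hp), by simp⟩
      · exact ⟨e, Finset.mem_union_left _ (Finset.mem_sdiff.2 ⟨he, heR⟩), hv⟩
  have heq := hM.2 M' hM' hcov
  obtain ⟨p, hp⟩ := hYne
  have h1 : s(f p, t p) ∈ M := by
    rw [← heq]
    exact Finset.mem_union_right _ (Finset.mem_image_of_mem (fun p => s(f p, t p)) hp)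
  have h2 := ht p (hYZ hp)
  rw [Sym2.eq_swap] at h1 h2
  exact hfY p hp (hM.1.partner h1 h2)

theorem bdd_ur {U : Type*} [Finite U] (H : SimpleGraph U) :
    BddAbove {k | ∃ M : Finset (Sym2 U), IsURMatching H M ∧ M.card = k} := by
  classical
  have := Fintype.ofFinite U
  refine ⟨Fintype.card (Sym2 U), ?_⟩
  rintro k ⟨M, -, rfl⟩
  exact Finset.card_le_univ M

theorem bdd_nu {U : Type*} [Finite U] (H : SimpleGraph U) :
    BddAbove {k | ∃ M : Finset (Sym2 U), IsMatchingSet H M ∧ M.card = k} := by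
  classical
  have := Fintype.ofFinite U
  refine ⟨Fintype.card (Sym2 U), ?_⟩
  rintro k ⟨M, -, rfl⟩
  exact Finset.card_le_univ M

theorem emptyMatching {U : Type*} (H : SimpleGraph U) : IsMatchingSet H ∅ := by
  constructor <;> simp

theorem emptyUR {U : Type*} (H : SimpleGraph U) : IsURMatching H ∅ := by
  refine ⟨emptyMatching H, ?_⟩
  intro M' _ h
  rw [Finset.eq_empty_iff_forall_notMem]
  rintro ⟨a, b⟩ he
  have : a ∈ covered M' := ⟨_, he, by simp⟩
  rw [h] at this
  obtain ⟨e, he, -⟩ := this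
  simp at he

theorem le_nuUR {U : Type*} [Finite U] {H : SimpleGraph U} {M} (h : IsURMatching H M) :
    M.card ≤ nuUR H := le_csSup (bdd_ur H) ⟨M, h, rfl⟩

theorem nuUR_le {U : Type*} {H : SimpleGraph U} {N : ℕ} (h : ∀ M, IsURMatching H M → M.card ≤ N) :
    nuUR H ≤ N := by
  refine csSup_le (s := {k | ∃ M : Finset (Sym2 U), IsURMatching H M ∧ M.card = k}) ⟨0, ∅, emptyUR H, rfl⟩ ?_
  rintro k ⟨M, hM, rfl⟩
  exact h M hM

theorem le_nu {U : Type*} [Finite U] {H : SimpleGraph U} {M} (h : IsMatchingSet H M) :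
    M.card ≤ nu H := le_csSup (bdd_nu H) ⟨M, h, rfl⟩

theorem exists_nu {U : Type*} [Finite U] (H : SimpleGraph U) :
    ∃ M, IsMatchingSet H M ∧ M.card = nu H :=
  Nat.sSup_mem (s := {k | ∃ M : Finset (Sym2 U), IsMatchingSet H M ∧ M.card = k})
    ⟨0, ∅, emptyMatching H, rfl⟩ (bdd_nu H)

theorem nuUR_mono {U W : Type*} [Finite U] [Finite W] (H : SimpleGraph U) (G : SimpleGraph W)
    (f : H ↪g G) : nuUR H ≤ nuUR G := by
  classical
  apply nuUR_le
  intro M hM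
  have hfi : Function.Injective (Sym2.map f) := Sym2.map.injective f.injective
  rw [← Finset.card_image_of_injective M hfi]
  apply le_nuUR
  constructor
  · constructor
    · intro e he
      obtain ⟨⟨a, b⟩, he', rfl⟩ := Finset.mem_image.1 he
      have : H.Adj a b := hM.1.1 _ he'
      exact f.map_adj_iff.2 this
    · intro e he g hg hne v hv hvg
      obtain ⟨e, he', rfl⟩ := Finset.mem_image.1 he
      obtain ⟨g, hg', rfl⟩ := Finset.mem_image.1 hg
      obtain ⟨x, hx, rfl⟩ := Sym2.mem_map.1 hv
      obtain ⟨y, hy, hxy⟩ := Sym2.mem_map.1 hvg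
      have := f.injective hxy
      subst this
      exact hne (by rw [hM.1.eq_of_mem he' hg' hx hy])
  · intro M' hM' hcov
    have hcov1 : ∀ v, v ∈ covered M' ↔ ∃ u ∈ covered M, f u = v := by
      intro v
      rw [hcov]
      constructor
      · rintro ⟨e, he, hv⟩
        obtain ⟨e, he', rfl⟩ := Finset.mem_image.1 he
        obtain ⟨x, hx, rfl⟩ := Sym2.mem_map.1 hv
        exact ⟨x, ⟨e, he', hx⟩, rfl⟩
      · rintro ⟨u, ⟨e, he, hu⟩, rfl⟩
        exact ⟨_, Finset.mem_image_of_mem _ he, Sym2.mem_map.2 ⟨u, hu, rfl⟩⟩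
    let M2 := M'.preimage (Sym2.map f) hfi.injOn
    have hran : ∀ e ∈ M', ∃ e' ∈ M2, Sym2.map f e' = e := by
      rintro ⟨a, b⟩ he
      obtain ⟨a, -, rfl⟩ := (hcov1 a).1 ⟨_, he, by simp⟩
      obtain ⟨b, -, rfl⟩ := (hcov1 b).1 ⟨_, he, by simp⟩
      exact ⟨s(a,b), by simpa [M2] using he, rfl⟩
    have hM2 : M2 = M := by
      apply hM.2
      · constructor
        · rintro ⟨a, b⟩ he
          have : s(f a, f b) ∈ M' := by simpa [M2] using he
          exact f.map_adj_iff.1 (hM'.1 _ this)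
        · intro e he g hg hne v hv hvg
          have he' : Sym2.map f e ∈ M' := by simpa [M2] using he
          have hg' : Sym2.map f g ∈ M' := by simpa [M2] using hg
          exact hne (hfi (hM'.eq_of_mem he' hg' (v := f v) (Sym2.mem_map.2 ⟨v, hv, rfl⟩) (Sym2.mem_map.2 ⟨v, hvg, rfl⟩)))
      · ext v
        constructor
        · rintro ⟨e, he, hv⟩
          have he' : Sym2.map f e ∈ M' := by simpa [M2] using he
          obtain ⟨u, hu, huv⟩ := (hcov1 (f v)).1 ⟨_, he', Sym2.mem_map.2 ⟨v, hv, rfl⟩⟩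
          rwa [← f.injective huv]
        · intro hv
          obtain ⟨e, he, hve⟩ := (hcov1 (f v)).2 ⟨v, hv, rfl⟩
          obtain ⟨e', he', rfl⟩ := hran e he
          obtain ⟨x, hx, hxv⟩ := Sym2.mem_map.1 hve
          rw [← f.injective hxv]
          exact ⟨e', he', hx⟩
    rw [← hM2]
    apply Finset.Subset.antisymm
    · intro e he
      obtain ⟨e', he', rfl⟩ := hran e he
      exact Finset.mem_image_of_mem _ he'
    · intro e he
      obtain ⟨e', he', rfl⟩ := Finset.mem_image.1 he
      simpa [M2] using he'



theorem tree_parent {V : Type*} {T : SimpleGraph V} (hT : T.IsTree) (r : V) {v x y : V}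
    (hx : T.Adj v x) (hy : T.Adj v y) (dx : T.dist r v = T.dist r x + 1)
    (dy : T.dist r v = T.dist r y + 1) : x = y := by
  obtain ⟨p, hp⟩ := hT.connected.exists_walk_length_eq_dist r x
  obtain ⟨q, hq⟩ := hT.connected.exists_walk_length_eq_dist r y
  have h1 : (p.concat hx.symm).IsPath := by
    apply Walk.isPath_of_length_eq_dist
    rw [Walk.length_concat]; omega
  have h2 : (q.concat hy.symm).IsPath := by
    apply Walk.isPath_of_length_eq_dist
    rw [Walk.length_concat]; omega
  have := (hT.existsUnique_path r v).unique h1 h2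
  have h3 := congrArg Walk.penultimate this
  simpa using h3

theorem konig_aux {V : Type*} [Fintype V] [DecidableEq V] {T : SimpleGraph V} (hT : T.IsTree) (r : V) :
    ∀ n : ℕ, ∀ U : Finset V, U.card = n → ∃ (M : Finset (Sym2 V)) (K : Finset V),
      IsMatchingSet T M ∧ (∀ e ∈ M, ∀ v ∈ e, v ∈ U) ∧
      (∀ a ∈ U, ∀ b ∈ U, T.Adj a b → a ∈ K ∨ b ∈ K) ∧ K.card ≤ M.card := by
  intro n
  induction n using Nat.strong_induction_on with
  | _ n ih =>
  intro U hU
  classical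
  let U' := U.filter (fun v => ∃ u ∈ U, T.Adj v u)
  by_cases hne : U'.Nonempty
  · obtain ⟨l, hl, hmax⟩ := U'.exists_max_image (fun v => T.dist r v) hne
    obtain ⟨hlU, s, hsU, hls⟩ := Finset.mem_filter.1 hl
    have hpar : ∀ x ∈ U, T.Adj l x → T.dist r l = T.dist r x + 1 := by
      intro x hx hlx
      rcases hT.dist_eq_dist_add_one_of_adj r hlx with h | h
      · exact h
      · have := hmax x (Finset.mem_filter.2 ⟨hx, l, hlU, hlx.symm⟩)
        omega
    have huniq : ∀ x ∈ U, T.Adj l x → x = s := fun x hx hlx =>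
      tree_parent hT r hlx hls (hpar x hx hlx) (hpar s hsU hls)
    have hlt : ((U.erase l).erase s).card < n := by
      have h1 := Finset.card_erase_lt_of_mem hlU
      have h2 := Finset.card_erase_le (s := U.erase l) (a := s)
      omega
    obtain ⟨M, K, hM, hMU, hK, hc⟩ := ih _ hlt _ rfl
    have hlM : ∀ e ∈ M, l ∉ e := fun e he h => by
      have := hMU e he l h; simp at this
    have hsM : ∀ e ∈ M, s ∉ e := fun e he h => by
      have := hMU e he s h; simp at this
    have hnotM : s(l, s) ∉ M := fun h => hlM _ h (by simp)
    refine ⟨insert s(l, s) M, insert s K, ⟨?_, ?_⟩, ?_, ?_, ?_⟩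
    · intro e he
      rcases Finset.mem_insert.1 he with rfl | he
      · exact hls
      · exact hM.1 e he
    · intro e he f hf hne v hv hvf
      rcases Finset.mem_insert.1 he with rfl | he' <;> rcases Finset.mem_insert.1 hf with rfl | hf'
      · exact hne rfl
      · rcases Sym2.mem_iff.1 hv with rfl | rfl
        · exact hlM f hf' hvf
        · exact hsM f hf' hvf
      · rcases Sym2.mem_iff.1 hvf with rfl | rfl
        · exact hlM e he' hv
        · exact hsM e he' hv
      · exact hM.2 e he' f hf' hne v hv hvf
    · intro e he v hv
      rcases Finset.mem_insert.1 he with rfl | he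
      · rcases Sym2.mem_iff.1 hv with rfl | rfl
        · exact hlU
        · exact hsU
      · have := hMU e he v hv
        simp at this; exact this.2.2
    · intro a ha b hb hab
      by_cases h1 : a = s
      · left; simp [h1]
      by_cases h2 : b = s
      · right; simp [h2]
      by_cases h3 : a = l
      · subst h3; exact absurd (huniq b hb hab) h2
      by_cases h4 : b = l
      · subst h4; exact absurd (huniq a ha hab.symm) h1
      rcases hK a (by simp [*]) b (by simp [*]) hab with h | h
      · left; simp [h]
      · right; simp [h]
    · rw [Finset.card_insert_of_notMem hnotM]
      exact (Finset.card_insert_le _ _).trans (by omega)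
  · refine ⟨∅, ∅, emptyMatching T, by simp, ?_, le_refl _⟩
    intro a ha b hb hab
    exact absurd ⟨a, Finset.mem_filter.2 ⟨ha, b, hb, hab⟩⟩ hne


theorem cover_exact {V : Type*} [DecidableEq V] {T : SimpleGraph V} {M : Finset (Sym2 V)} {K : Finset V}
    (hM : IsMatchingSet T M) (hK : ∀ a b, T.Adj a b → a ∈ K ∨ b ∈ K) (hc : K.card ≤ M.card) :
    (∀ k ∈ K, k ∈ covered M) ∧ (∀ a b, s(a,b) ∈ M → a ∈ K → b ∉ K) ∧ K.card = M.card := by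
  have hex : ∀ e ∈ M, ∃ v, v ∈ e ∧ v ∈ K := by
    rintro ⟨a, b⟩ he
    rcases hK a b (hM.1 _ he) with h | h
    · exact ⟨a, by simp, h⟩
    · exact ⟨b, by simp, h⟩
  by_cases hVe : Nonempty V
  swap
  · exact ⟨fun k => (hVe ⟨k⟩).elim, fun k => (hVe ⟨k⟩).elim, by
      have h1 : K = ∅ := Finset.eq_empty_of_forall_notMem fun k => (hVe ⟨k⟩).elim
      have h2 : M = ∅ := Finset.eq_empty_of_forall_notMem fun e he => by
        obtain ⟨k, -⟩ := hex e he
        exact hVe ⟨k⟩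
      rw [h1, h2]; rfl⟩
  choose! g hg using hex
  have hinj : Set.InjOn g M := by
    intro e he f hf h
    exact hM.eq_of_mem he hf (hg e he).1 (h ▸ (hg f hf).1)
  have him : M.image g = K := by
    apply Finset.eq_of_subset_of_card_le
    · intro v hv
      obtain ⟨e, he, rfl⟩ := Finset.mem_image.1 hv
      exact (hg e he).2
    · rw [Finset.card_image_of_injOn hinj]; exact hc
  have key : ∀ k ∈ K, ∀ e ∈ M, k ∈ e → g e = k := by
    intro k hk e he hke
    rw [← him] at hk
    obtain ⟨f, hf, rfl⟩ := Finset.mem_image.1 hk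
    rw [hM.eq_of_mem he hf hke (hg f hf).1]
  refine ⟨?_, ?_, ?_⟩
  · intro k hk
    rw [← him] at hk
    obtain ⟨e, he, rfl⟩ := Finset.mem_image.1 hk
    exact ⟨e, he, (hg e he).1⟩
  · intro a b he ha hb
    have h1 := key a ha _ he (by simp)
    have h2 := key b hb _ he (by simp)
    have : T.Adj a b := hM.1 _ he
    exact this.ne (h1.symm.trans h2)
  · rw [← him, Finset.card_image_of_injOn hinj]

theorem tree_struct {V : Type*} [Finite V] {T : SimpleGraph V} (hT : MemT T) :
    (∀ u ∈ gallaiD T, ∀ v ∈ gallaiD T, ¬ T.Adj u v) ∧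
    (∀ v ∉ gallaiD T, (T.neighborSet v).ncard = 3) ∧
    (∀ v ∉ gallaiD T, ∀ u, T.Adj v u → u ∈ gallaiD T) := by
  classical
  have := Fintype.ofFinite V
  obtain ⟨hTree, hdeg, hn⟩ := hT
  obtain ⟨r⟩ := hTree.connected.nonempty
  obtain ⟨M, hM, hMc⟩ := exists_nu T
  set D := gallaiD T with hD
  -- covers
  have hcov0 : ∃ K : Finset V, (∀ a b, T.Adj a b → a ∈ K ∨ b ∈ K) ∧ K.card ≤ nu T := by
    obtain ⟨M, K, h1, h2, h3, h4⟩ := konig_aux hTree r _ Finset.univ rfl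
    exact ⟨K, fun a b => h3 a (by simp) b (by simp), h4.trans (le_nu h1)⟩
  have hcov1 : ∀ v ∉ D, ∃ K : Finset V, (∀ a b, T.Adj a b → a ∈ K ∨ b ∈ K) ∧ K.card ≤ nu T ∧ v ∈ K := by
    intro v hv
    obtain ⟨M, K, h1, h2, h3, h4⟩ := konig_aux hTree r _ (Finset.univ.erase v) rfl
    have hlt : M.card < nu T := by
      apply lt_of_le_of_ne (le_nu h1)
      intro h
      apply hv
      refine ⟨M, h1, h, ?_⟩
      rintro ⟨e, he, hve⟩
      have := h2 e he v hve
      simp at this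
    refine ⟨insert v K, ?_, (Finset.card_insert_le _ _).trans (by omega), by simp⟩
    intro a b hab
    by_cases h1 : a = v
    · left; simp [h1]
    by_cases h2 : b = v
    · right; simp [h2]
    rcases h3 a (by simp [h1]) b (by simp [h2]) hab with h | h
    · left; simp [h]
    · right; simp [h]
  have hDK : ∀ K : Finset V, (∀ a b, T.Adj a b → a ∈ K ∨ b ∈ K) → K.card ≤ nu T → ∀ d ∈ D, d ∉ K := by
    intro K h1 h2 d hd hdK
    obtain ⟨M', hM', hc', hd'⟩ := hd
    exact hd' ((cover_exact hM' h1 (by omega)).1 d hdK)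
  have hAK : ∀ K : Finset V, (∀ a b, T.Adj a b → a ∈ K ∨ b ∈ K) → K.card ≤ nu T →
      ∀ a d, d ∈ D → T.Adj a d → a ∈ K := by
    intro K h1 h2 a d hd had
    rcases h1 a d had with h | h
    · exact h
    · exact absurd h (hDK K h1 h2 d hd)
  obtain ⟨K, hK, hKc⟩ := hcov0
  obtain ⟨hKM, hKe, hKc'⟩ := cover_exact hM hK (by omega)
  have hDind : ∀ u ∈ D, ∀ v ∈ D, ¬ T.Adj u v := by
    intro u hu v hv huv
    exact hDK K hK hKc u hu (hAK K hK hKc u v hv huv)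
  let A : Finset V := Finset.univ.filter (fun v => v ∉ D ∧ ∃ d ∈ D, T.Adj v d)
  let C : Finset V := Finset.univ.filter (fun v => v ∉ D ∧ ¬ ∃ d ∈ D, T.Adj v d)
  have hA : ∀ v, v ∈ A ↔ v ∉ D ∧ ∃ d ∈ D, T.Adj v d := fun v => by simp [A]
  have hC : ∀ v, v ∈ C ↔ v ∉ D ∧ ¬ ∃ d ∈ D, T.Adj v d := fun v => by simp [C]
  have hKAC : K.card = A.card + (C ∩ K).card := by
    rw [← Finset.card_union_of_disjoint]
    · congr 1
      ext v
      rw [Finset.mem_union, Finset.mem_inter, hA, hC]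
      constructor
      · intro hv
        have hvD : v ∉ D := fun h => hDK K hK hKc v h hv
        by_cases h : ∃ d ∈ D, T.Adj v d
        · exact Or.inl ⟨hvD, h⟩
        · exact Or.inr ⟨⟨hvD, h⟩, hv⟩
      · rintro (⟨_, d, hd, hvd⟩ | h)
        · exact hAK K hK hKc v d hd hvd
        · exact h.2
    · rw [Finset.disjoint_left]
      intro v hv hv'
      rw [hA] at hv
      rw [Finset.mem_inter, hC] at hv'
      exact hv'.1.2 hv.2
  have hCle : (C \ K).card ≤ (C ∩ K).card := by
    have hpart : ∀ c ∈ C \ K, ∃ x, s(c, x) ∈ M ∧ x ∈ C ∩ K := by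
      intro c hc
      rw [Finset.mem_sdiff, hC] at hc
      have hcM : c ∈ covered M := by
        by_contra h
        exact hc.1.1 ⟨M, hM, hMc, h⟩
      obtain ⟨e, he, x, rfl⟩ := hcM
      have hcx : T.Adj c x := hM.1 _ he
      have hxK : x ∈ K := by
        rcases hK c x hcx with h | h
        · exact absurd h hc.2
        · exact h
      have hxD : x ∉ D := fun h => hDK K hK hKc x h hxK
      refine ⟨x, he, Finset.mem_inter.2 ⟨(hC x).2 ⟨hxD, ?_⟩, hxK⟩⟩
      rintro ⟨d, hd, hxd⟩
      obtain ⟨K', h1, h2, h3⟩ := hcov1 c hc.1.1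
      exact (cover_exact hM h1 (by omega)).2.1 c x he h3 (hAK K' h1 h2 x d hd hxd)
    choose! g hg using hpart
    apply Finset.card_le_card_of_injOn g (fun c hc => (hg c hc).2)
    intro c hc c' hc' h
    have h1 := (hg c hc).1
    have h2 := (hg c' hc').1
    rw [h, Sym2.eq_swap] at h1
    rw [Sym2.eq_swap] at h2
    exact hM.partner h1 h2
  have hCcard : C.card = (C \ K).card + (C ∩ K).card := (Finset.card_sdiff_add_card_inter C K).symm
  have hE : T.edgeFinset.card = 3 * nu T := by
    have := hTree.card_edgeFinset
    rw [Nat.card_eq_fintype_card] at hn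
    omega
  let EC := T.edgeFinset.filter (fun e => ∀ v ∈ e, v ∈ C)
  have hEC : EC.card ≤ C.card := by
    have hex : ∀ e ∈ EC, ∃ v x, e = s(v, x) ∧ v ∈ C ∧ T.Adj v x ∧ T.dist r v = T.dist r x + 1 := by
      rintro ⟨a, b⟩ he
      obtain ⟨he1, he2⟩ := Finset.mem_filter.1 he
      have hab : T.Adj a b := by simpa using he1
      rcases hTree.dist_eq_dist_add_one_of_adj r hab with h | h
      · exact ⟨a, b, rfl, he2 a (by simp), hab, h⟩
      · exact ⟨b, a, Sym2.eq_swap, he2 b (by simp), hab.symm, h⟩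
    haveI : Nonempty V := ⟨r⟩
    choose! g x hg using hex
    apply Finset.card_le_card_of_injOn g (fun c hc => (hg c hc).2.1)
    intro e he f hf h
    obtain ⟨h1, _, h3, h4⟩ := hg e he
    obtain ⟨k1, _, k3, k4⟩ := hg f hf
    rw [← h] at k1 k3 k4
    have := tree_parent hTree r h3 k3 h4 k4
    rw [h1, k1, this]
  have hEsub : T.edgeFinset ⊆ A.biUnion (fun a => T.incidenceFinset a) ∪ EC := by
    rintro ⟨a, b⟩ he
    have hab : T.Adj a b := by simpa using he
    rw [Finset.mem_union, Finset.mem_biUnion]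
    by_cases h1 : a ∈ A
    · left; exact ⟨a, h1, by simp [mem_incidenceFinset, incidenceSet, hab]⟩
    by_cases h2 : b ∈ A
    · left; exact ⟨b, h2, by simp [mem_incidenceFinset, incidenceSet, hab]⟩
    right
    rw [hA] at h1 h2
    have ha : a ∉ D := fun ha => by
      have hb : b ∉ D := fun hb => hDind a ha b hb hab
      exact h2 ⟨hb, a, ha, hab.symm⟩
    have hb : b ∉ D := fun hb => h1 ⟨ha, b, hb, hab⟩
    refine Finset.mem_filter.2 ⟨he, ?_⟩
    intro v hv
    rcases Sym2.mem_iff.1 hv with rfl | rfl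
    · exact (hC _).2 ⟨ha, fun h => h1 ⟨ha, h⟩⟩
    · exact (hC _).2 ⟨hb, fun h => h2 ⟨hb, h⟩⟩
  have hdeg' : ∀ a ∈ A, T.degree a ≤ 3 := by
    intro a ha
    rw [hA] at ha
    have := hdeg a ha
    rwa [Set.ncard_eq_toFinset_card', ← SimpleGraph.neighborFinset_def, SimpleGraph.card_neighborFinset_eq_degree] at this
  have hinc : ∀ a ∈ A, (T.incidenceFinset a).card ≤ 3 := by
    intro a ha
    rw [SimpleGraph.card_incidenceFinset_eq_degree]; exact hdeg' a ha
  have hsumle : ∀ B ⊆ A, (B.biUnion (fun a => T.incidenceFinset a)).card ≤ 3 * B.card := by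
    intro B hB
    refine Finset.card_biUnion_le.trans ?_
    calc _ ≤ ∑ a ∈ B, 3 := Finset.sum_le_sum (fun a ha => hinc a (hB ha))
      _ = _ := by simp [mul_comm]
  have hC0 : C.card = 0 := by
    have h1 := Finset.card_le_card hEsub
    have h2 := Finset.card_union_le (A.biUnion (fun a => T.incidenceFinset a)) EC
    have h3 := hsumle A (le_refl _)
    omega
  have hC0' : C = ∅ := Finset.card_eq_zero.1 hC0
  have hEC0 : EC.card = 0 := by omega
  have hEC0' : EC = ∅ := Finset.card_eq_zero.1 hEC0
  have hAcard : T.edgeFinset.card = 3 * A.card := by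
    have := Finset.card_le_card (Finset.inter_subset_left : C ∩ K ⊆ C)
    omega
  rw [hEC0', Finset.union_empty] at hEsub
  have hnD : ∀ v ∉ D, v ∈ A := by
    intro v hv
    by_contra h
    have : v ∈ C := (hC v).2 ⟨hv, fun h' => h ((hA v).2 ⟨hv, h'⟩)⟩
    rw [hC0'] at this; simp at this
  -- replacing one vertex
  have hone : ∀ a ∈ A, ∀ F : Finset (Sym2 V),
      T.edgeFinset ⊆ F ∪ (A.erase a).biUnion (fun a => T.incidenceFinset a) → 3 ≤ F.card := by
    intro a ha F hF
    have h1 := Finset.card_le_card hF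
    have h2 := Finset.card_union_le F ((A.erase a).biUnion (fun a => T.incidenceFinset a))
    have h3 := hsumle (A.erase a) (Finset.erase_subset _ _)
    rw [Finset.card_erase_of_mem ha] at h3
    have := Finset.card_pos.2 ⟨a, ha⟩
    omega
  refine ⟨hDind, ?_, ?_⟩
  · intro v hv
    have hvA := hnD v hv
    have h1 := hone v hvA (T.incidenceFinset v) (by
      have := Finset.biUnion_insert (s := A.erase v) (a := v) (t := fun a => T.incidenceFinset a)
      rw [← this, Finset.insert_erase hvA]; exact hEsub)
    have h2 := hinc v hvA
    rw [SimpleGraph.card_incidenceFinset_eq_degree] at h1 h2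
    rw [Set.ncard_eq_toFinset_card', ← SimpleGraph.neighborFinset_def, SimpleGraph.card_neighborFinset_eq_degree]
    omega
  · intro v hv u hvu
    by_contra hu
    have hvA := hnD v hv
    have huA := hnD u hu
    have h1 := hone v hvA ((T.incidenceFinset v).erase s(v, u)) (by
      intro e he
      rw [Finset.mem_union, Finset.mem_erase, Finset.mem_biUnion]
      obtain ⟨a, ha, hea⟩ := Finset.mem_biUnion.1 (hEsub he)
      by_cases h : e = s(v, u)
      · right
        refine ⟨u, Finset.mem_erase.2 ⟨hvu.ne.symm, huA⟩, ?_⟩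
        subst h
        simp [mem_incidenceFinset, incidenceSet, hvu]
      · by_cases hav : a = v
        · left; subst hav; exact ⟨h, hea⟩
        · right; exact ⟨a, Finset.mem_erase.2 ⟨hav, ha⟩, hea⟩)
    have h2 := hinc v hvA
    have h3 : s(v, u) ∈ T.incidenceFinset v := by
      simp [mem_incidenceFinset, incidenceSet, hvu]
    rw [Finset.card_erase_of_mem h3] at h1
    omega



structure BD {n : ℕ} (B : SimpleGraph (Fin n)) (P : Finset (Fin n)) (c : ℕ) (three : Prop) : Prop where
  bip : ∀ x y, B.Adj x y → (x ∈ P ↔ y ∉ P)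
  deg : ∀ x ∈ P, (B.neighborSet x).ncard ≠ 2
  degge : ∀ x, 2 ≤ (B.neighborSet x).ncard
  up : ∀ Z ⊆ P, c < Z.card → ∃ Z' ⊆ Z, Z'.Nonempty ∧
    ∀ p ∈ Z', ∀ q, B.Adj p q → ∃ p' ∈ Z', p' ≠ p ∧ B.Adj p' q
  low : ∀ Y : Finset (Fin n), (∀ y ∈ Y, (B.neighborSet y).ncard = 2) →
    (Y.card ≤ 2 ∨ (three ∧ Y.card = 3 ∧ ¬ ∃ w, ∀ y ∈ Y, B.Adj w y)) →
    ∃ Z ⊆ P, Z.card = c ∧ ∃ (m : Fin n → Fin n) (r : Fin n → ℕ), ∀ p ∈ Z, B.Adj p (m p) ∧ m p ∉ Y ∧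
      ∀ p' ∈ Z, p' ≠ p → B.Adj p' (m p) → r p' < r p
  all3 : ¬ three → ∀ Y : Finset (Fin n), (∀ y ∈ Y, (B.neighborSet y).ncard = 2) → Y.card = 3 →
    ∀ y, (B.neighborSet y).ncard = 2 → y ∈ Y

/-- executable adjacency -/
def adjB (n : ℕ) (A : ℕ) (i j : Fin n) : Bool := A.testBit (n * i.val + j.val)

def mOf {n : ℕ} (l : List (Fin n × Fin n)) (p : Fin n) : Fin n := (l.lookup p).getD p
def rOf {n : ℕ} (l : List (Fin n × Fin n)) (p : Fin n) : ℕ := (l.map Prod.fst).idxOf p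

def degB (n A : ℕ) (x : Fin n) : ℕ := ((List.finRange n).filter (adjB n A x)).length

def chk1 (n A : ℕ) (P D2 : List (Fin n)) : Bool :=
  (List.finRange n).all fun x =>
    decide (2 ≤ degB n A x) && (D2.contains x == decide (degB n A x = 2)) &&
    !(P.contains x && D2.contains x) &&
    (List.finRange n).all fun y => !adjB n A x y || (P.contains x == !P.contains y)

def chk2 (n A c : ℕ) (P : List (Fin n)) (stops : List (List (Fin n))) : Bool :=
  (stops.all fun s => !s.isEmpty && s.all fun p => (List.finRange n).all fun q => !adjB n A p q ||
    s.any fun p' => decide (p' ≠ p) && adjB n A p' q) &&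
  (List.sublistsLen (c+1) P).all fun Z => stops.any fun s => s.all fun p => Z.contains p

def chk3 (n A c : ℕ) (P : List (Fin n)) (seqs : List (List (Fin n × Fin n))) : Bool :=
  seqs.all fun l => decide (l.map Prod.fst).Nodup && decide (l.length = c) &&
    l.all fun s => P.contains s.1 && adjB n A s.1 s.2 && decide (mOf l s.1 = s.2) &&
      l.all fun t => decide (t.1 = s.1) || !adjB n A t.1 s.2 || decide (rOf l t.1 < rOf l s.1)

def cov (n A k : ℕ) (D2 : List (Fin n)) (seqs : List (List (Fin n × Fin n))) : Bool :=
  (List.sublistsLen k D2).all fun Y =>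
    (decide (k = 3) && (List.finRange n).any fun w => Y.all fun y => adjB n A w y) ||
    seqs.any fun l => l.all fun s => !Y.contains s.2

theorem mem_sublistsLen_of {n : ℕ} (L : List (Fin n)) (hL : L.Nodup) (Z : Finset (Fin n)) (k : ℕ)
    (hZ : ∀ z ∈ Z, z ∈ L) (hk : Z.card = k) : ∃ l ∈ List.sublistsLen k L, ∀ x, x ∈ l ↔ x ∈ Z := by
  have h2 : ∀ x, x ∈ L.filter (fun x => decide (x ∈ Z)) ↔ x ∈ Z := by
    intro x; simp only [List.mem_filter, decide_eq_true_eq]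
    exact ⟨fun h => h.2, fun h => ⟨hZ x h, h⟩⟩
  refine ⟨_, List.mem_sublistsLen.2 ⟨List.filter_sublist, ?_⟩, h2⟩
  have h1 : (L.filter (fun x => decide (x ∈ Z))).toFinset = Z := by
    ext x; rw [List.mem_toFinset, h2]
  rw [← hk, ← List.toFinset_card_of_nodup (hL.filter _), h1]

theorem BD.mk' {n : ℕ} (B : SimpleGraph (Fin n)) (A : ℕ) (P : List (Fin n)) (c : ℕ) (three : Prop)
    (D2 : List (Fin n)) (stops : List (List (Fin n)))
    (seqs : List (List (Fin n × Fin n)))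
    (hE : ∀ i j, B.Adj i j ↔ adjB n A i j = true)
    (hP : P.Nodup) (hD : D2.Nodup) (hD2 : 2 ≤ D2.length)
    (h1 : chk1 n A P D2 = true) (h2 : chk2 n A c P stops = true) (h3 : chk3 n A c P seqs = true)
    (h4 : cov n A 2 D2 seqs = true) (h5 : three → cov n A 3 D2 seqs = true)
    (h8 : ¬ three → D2.length = 3) : BD B P.toFinset c three := by
  have hn : ∀ x, (B.neighborSet x).ncard = degB n A x := by
    intro x
    rw [degB, ← List.toFinset_card_of_nodup ((List.nodup_finRange n).filter _), ← Set.ncard_coe_finset]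
    congr 1
    ext y
    simp [hE]
  simp only [chk1, List.all_eq_true, List.mem_finRange, true_implies, Bool.and_eq_true, decide_eq_true_eq,
    beq_iff_eq, Bool.not_eq_true', Bool.or_eq_true, List.contains_eq_mem] at h1
  have hd : ∀ x, (B.neighborSet x).ncard = 2 ↔ x ∈ D2 := by
    intro x
    have := (h1 x).1.1.2
    rw [decide_eq_decide] at this
    rw [hn, this]
  have hlow : ∀ (k : ℕ), cov n A k D2 seqs = true → ∀ Y : Finset (Fin n), (∀ y ∈ Y, y ∈ D2) → Y.card = k →
     (k = 3 → ¬ ∃ w, ∀ y ∈ Y, B.Adj w y) → ∃ Z ⊆ P.toFinset, Z.card = c ∧ ∃ (m : Fin n → Fin n) (r : Fin n → ℕ), ∀ p ∈ Z, B.Adj p (m p) ∧ m p ∉ Y ∧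
      ∀ p' ∈ Z, p' ≠ p → B.Adj p' (m p) → r p' < r p := by
    intro k hk Y hY hc hno
    obtain ⟨L, hL, hLY⟩ := mem_sublistsLen_of D2 hD Y k hY hc
    simp only [cov, List.all_eq_true, List.any_eq_true, List.mem_finRange, true_implies, Bool.and_eq_true, decide_eq_true_eq,
      Bool.not_eq_true', Bool.or_eq_true, List.contains_eq_mem, true_and, decide_eq_false_iff_not] at hk
    rcases hk L hL with ⟨h, w, hw⟩ | ⟨l, hl, h⟩
    · exact absurd ⟨w, fun y hy => (hE _ _).2 (hw y ((hLY y).2 hy))⟩ (hno h)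
    · simp only [chk3, List.all_eq_true, Bool.and_eq_true, decide_eq_true_eq,
        Bool.not_eq_true', Bool.or_eq_true, List.contains_eq_mem] at h3
      obtain ⟨⟨a, b⟩, d⟩ := h3 l hl
      refine ⟨(l.map Prod.fst).toFinset, ?_, ?_, mOf l, rOf l, ?_⟩
      · intro x hx
        rw [List.mem_toFinset, List.mem_map] at hx
        obtain ⟨s, hs, rfl⟩ := hx
        exact List.mem_toFinset.2 (d s hs).1.1.1
      · rw [List.toFinset_card_of_nodup a, List.length_map, b]
      · intro p hp
        rw [List.mem_toFinset, List.mem_map] at hp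
        obtain ⟨s, hs, rfl⟩ := hp
        obtain ⟨⟨⟨_, e1⟩, e2⟩, e3⟩ := d s hs
        rw [e2]
        refine ⟨(hE _ _).2 e1, fun h' => h s hs ((hLY _).2 h'), ?_⟩
        intro p' hp' hne hadj
        rw [List.mem_toFinset, List.mem_map] at hp'
        obtain ⟨t, ht, rfl⟩ := hp'
        rcases e3 t ht with (h' | h') | h'
        · exact absurd h' hne
        · rw [hE, h'] at hadj; cases hadj
        · exact h'
  refine ⟨?_, ?_, ?_, ?_, ?_, ?_⟩
  · intro x y h
    rcases (h1 x).2 y with h' | h'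
    · rw [hE, h'] at h; cases h
    · simp only [List.mem_toFinset]
      by_cases hx : x ∈ P <;> by_cases hy : y ∈ P <;> simp_all
  · intro x hx h
    rw [List.mem_toFinset] at hx
    have := (h1 x).1.2
    simp [hx, (hd x).1 h] at this
  · intro x; rw [hn]; exact (h1 x).1.1.1
  · intro Z hZ hc
    obtain ⟨Z1, hZ1, hZ1c⟩ := Finset.exists_subset_card_eq (s := Z) (n := c + 1) hc
    obtain ⟨L, hL, hLZ⟩ := mem_sublistsLen_of P hP Z1 _ (fun z hz => List.mem_toFinset.1 (hZ (hZ1 hz))) hZ1c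
    simp only [chk2, List.all_eq_true, List.any_eq_true, List.mem_finRange, true_implies, Bool.and_eq_true, decide_eq_true_eq,
      Bool.not_eq_true', Bool.or_eq_true, List.contains_eq_mem] at h2
    obtain ⟨s, hs, hsL⟩ := h2.2 L hL
    obtain ⟨h2a, h2b⟩ := h2.1 s hs
    refine ⟨s.toFinset, ?_, ?_, ?_⟩
    · intro x hx
      exact hZ1 ((hLZ x).1 (hsL x (List.mem_toFinset.1 hx)))
    · rcases s with _ | ⟨x, s⟩
      · simp at h2a
      · exact ⟨x, by simp⟩
    · intro p hp q hpq
      rcases h2b p (List.mem_toFinset.1 hp) q with h' | ⟨p', a, b, d⟩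
      · rw [hE, h'] at hpq; cases hpq
      · exact ⟨p', List.mem_toFinset.2 a, b, (hE _ _).2 d⟩
  · intro Y hY hc
    rcases hc with hc | ⟨ht, hc, hno⟩
    · obtain ⟨Y', hYY', hY', hc'⟩ := Finset.exists_subsuperset_card_eq (s := Y) (t := D2.toFinset) (n := 2)
        (fun y hy => List.mem_toFinset.2 ((hd y).1 (hY y hy))) hc (by rwa [List.toFinset_card_of_nodup hD])
      obtain ⟨Z, a, b, m, r, d⟩ := hlow 2 h4 Y' (fun y hy => List.mem_toFinset.1 (hY' hy)) hc' (by omega)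
      exact ⟨Z, a, b, m, r, fun p hp => ⟨(d p hp).1, fun h => (d p hp).2.1 (hYY' h), (d p hp).2.2⟩⟩
    · exact hlow 3 (h5 ht) Y (fun y hy => (hd y).1 (hY y hy)) hc (fun _ => hno)
  · intro ht Y hY hc y hy
    have : Y = D2.toFinset := Finset.eq_of_subset_of_card_le (fun y hy => List.mem_toFinset.2 ((hd y).1 (hY y hy)))
      (by rw [List.toFinset_card_of_nodup hD, h8 ht, hc])
    rw [this]; exact List.mem_toFinset.2 ((hd y).1 hy)

set_option maxRecDepth 100000 in
theorem bd1 : BD BG1 (List.toFinset [0, 1, 2, 3]) 3 True :=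
  BD.mk' _ 14867376823552361128593342576 _ _ _
    [4, 5, 6, 7, 8, 9]
    [[0, 1, 2, 3]]
    [[(0,6), (1,8), (2,9)],
     [(2,9), (0,5), (1,7)],
     [(1,8), (0,4), (2,7)],
     [(0,6), (1,4), (2,5)],
     [(0,6), (2,9), (1,7)],
     [(0,6), (1,8), (2,7)],
     [(1,8), (2,9), (0,5)],
     [(1,8), (2,7), (0,5)],
     [(0,6), (2,5), (1,8)],
     [(0,6), (2,5), (1,7)],
     [(1,8), (0,4), (2,9)],
     [(2,9), (1,7), (0,4)],
     [(0,6), (1,4), (2,9)],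
     [(0,6), (1,4), (2,7)],
     [(2,9), (0,5), (1,4)],
     [(1,8), (0,4), (2,5)]]
    (by
      intro i j
      rw [BG1, SimpleGraph.fromEdgeSet_adj]
      simp only [Set.mem_insert_iff, Set.mem_singleton_iff]
      revert i j
      decide +kernel)
    (by decide +kernel) (by decide +kernel) (by decide +kernel) (by decide +kernel) (by decide +kernel)
    (by decide +kernel) (by decide +kernel) (by decide +kernel) (by decide +kernel)

set_option maxRecDepth 100000 in
theorem bd2 : BD BG2 (List.toFinset [4, 5, 6, 7, 8, 9]) 4 False :=
  BD.mk' _ 48232765601247842825319707940595727652440237015152 _ _ _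
    [10, 11, 12]
    [[4, 5, 8, 9], [4, 6, 7, 9], [5, 6, 7, 8]]
    [[(6,3), (4,12), (5,0), (7,1)],
     [(6,3), (5,11), (4,0), (7,1)],
     [(6,3), (7,10), (4,1), (5,0)]]
    (by
      intro i j
      rw [BG2, SimpleGraph.fromEdgeSet_adj]
      simp only [Set.mem_insert_iff, Set.mem_singleton_iff]
      revert i j
      decide +kernel)
    (by decide +kernel) (by decide +kernel) (by decide +kernel) (by decide +kernel) (by decide +kernel)
    (by decide +kernel) (by decide +kernel) (by decide +kernel) (by decide +kernel)

set_option maxRecDepth 100000 in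
theorem bd3 : BD BG3 (List.toFinset [0, 2, 4, 6, 8, 10, 15]) 5 True :=
  BD.mk' _ 50659950516789895752629197668204567204552503836465428268790351461592512925730 _ _ _
    [1, 3, 5, 7, 9, 11]
    [[0, 2, 4, 15], [6, 8, 10, 15], [0, 2, 4, 6, 8, 10]]
    [[(8,9), (6,7), (0,12), (2,13), (4,14)],
     [(4,14), (2,3), (0,1), (6,12), (8,13)],
     [(8,9), (6,11), (0,12), (4,5), (2,13)],
     [(6,11), (8,7), (0,12), (4,5), (2,13)],
     [(8,9), (6,11), (0,12), (2,13), (4,3)],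
     [(6,11), (8,7), (0,12), (2,13), (4,3)],
     [(6,11), (0,12), (4,5), (2,3), (8,13)],
     [(8,9), (2,13), (4,3), (0,5), (6,12)],
     [(4,14), (2,3), (0,5), (6,12), (8,7)],
     [(8,9), (6,11), (0,12), (2,1), (4,14)],
     [(6,11), (8,7), (0,12), (2,1), (4,14)],
     [(6,11), (0,12), (2,1), (4,5), (8,13)],
     [(8,9), (2,13), (0,1), (4,5), (6,12)],
     [(4,14), (0,5), (2,1), (6,12), (8,7)]]
    (by
      intro i j
      rw [BG3, SimpleGraph.fromEdgeSet_adj]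
      simp only [Set.mem_insert_iff, Set.mem_singleton_iff]
      revert i j
      decide +kernel)
    (by decide +kernel) (by decide +kernel) (by decide +kernel) (by decide +kernel) (by decide +kernel)
    (by decide +kernel) (by decide +kernel) (by decide +kernel) (by decide +kernel)

set_option maxRecDepth 100000 in
theorem bd4 : BD BG4 (List.toFinset [1, 3, 5, 7, 9, 11, 12, 14, 16]) 6 False :=
  BD.mk' _ 770615570524066150079866561950145091919741928665835295673578885999322201010667153606783304055399734240088098 _ _ _
    [13, 15, 17]
    [[1, 7, 12, 14], [3, 9, 14, 16], [5, 11, 12, 16], [1, 3, 5, 7, 9, 11], [1, 3, 7, 9, 12, 16], [1, 5, 7, 11, 14, 16], [3, 5, 9, 11, 12, 14]]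
    [[(9,10), (7,8), (12,6), (5,17), (1,0), (3,2)],
     [(9,10), (7,8), (12,6), (3,15), (1,2), (5,0)],
     [(9,10), (7,8), (12,6), (1,13), (5,0), (3,2)]]
    (by
      intro i j
      rw [BG4, SimpleGraph.fromEdgeSet_adj]
      simp only [Set.mem_insert_iff, Set.mem_singleton_iff]
      revert i j
      decide +kernel)
    (by decide +kernel) (by decide +kernel) (by decide +kernel) (by decide +kernel) (by decide +kernel)
    (by decide +kernel) (by decide +kernel) (by decide +kernel) (by decide +kernel)



structure FBD {W : Type} (G : SimpleGraph W) (F : Set W) (P : Finset W) (c : ℕ) (three : Prop) : Prop where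
  sub : ∀ p ∈ P, p ∈ F
  bip : ∀ x ∈ F, ∀ y ∈ F, G.Adj x y → (x ∈ P ↔ y ∉ P)
  deg : ∀ x ∈ P, (G.neighborSet x ∩ F).ncard ≠ 2
  degge : ∀ x ∈ F, 2 ≤ (G.neighborSet x ∩ F).ncard
  up : ∀ Z ⊆ P, c < Z.card → ∃ Z' ⊆ Z, Z'.Nonempty ∧
    ∀ p ∈ Z', ∀ q ∈ F, G.Adj p q → ∃ p' ∈ Z', p' ≠ p ∧ G.Adj p' q
  low : ∀ Y : Finset W, (∀ y ∈ Y, y ∈ F ∧ (G.neighborSet y ∩ F).ncard = 2) →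
    (Y.card ≤ 2 ∨ (three ∧ Y.card = 3 ∧ ¬ ∃ w ∈ F, ∀ y ∈ Y, G.Adj w y)) →
    ∃ Z ⊆ P, Z.card = c ∧ ∃ (m : W → W) (r : W → ℕ), ∀ p ∈ Z, m p ∈ F ∧ G.Adj p (m p) ∧ m p ∉ Y ∧
      ∀ p' ∈ Z, p' ≠ p → G.Adj p' (m p) → r p' < r p
  all3 : ¬ three → ∀ Y : Finset W, (∀ y ∈ Y, y ∈ F ∧ (G.neighborSet y ∩ F).ncard = 2) → Y.card = 3 →
    ∀ y ∈ F, (G.neighborSet y ∩ F).ncard = 2 → y ∈ Y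

theorem BD.transport {W : Type} (G : SimpleGraph W) {n : ℕ} {B : SimpleGraph (Fin n)}
    {P : Finset (Fin n)} {c : ℕ} {three : Prop} (h : BD B P c three) (φ : B ↪g G) :
    FBD G (Set.range φ) (P.map φ.toEmbedding) c three := by
  classical
  have hinj : Function.Injective φ := φ.injective
  have hadj : ∀ a b, G.Adj (φ a) (φ b) ↔ B.Adj a b := fun a b => φ.map_adj_iff
  have hn : ∀ x, (G.neighborSet (φ x) ∩ Set.range φ).ncard = (B.neighborSet x).ncard := by
    intro x
    have : G.neighborSet (φ x) ∩ Set.range φ = φ '' B.neighborSet x := by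
      ext y
      constructor
      · rintro ⟨h1, z, rfl⟩
        exact ⟨z, (hadj _ _).1 h1, rfl⟩
      · rintro ⟨z, hz, rfl⟩
        exact ⟨(hadj _ _).2 hz, z, rfl⟩
    rw [this, Set.ncard_image_of_injective _ hinj]
  have hP : ∀ x, φ x ∈ P.map φ.toEmbedding ↔ x ∈ P := fun x => Finset.mem_map' φ.toEmbedding
  have pre : ∀ Y : Finset W, (∀ y ∈ Y, y ∈ Set.range φ) → ∃ Y' : Finset (Fin n), Y = Y'.map φ.toEmbedding := by
    intro Y hY
    refine ⟨Y.preimage φ hinj.injOn, ?_⟩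
    ext y
    simp only [Finset.mem_map, Finset.mem_preimage]
    constructor
    · intro hy
      obtain ⟨z, rfl⟩ := hY y hy
      exact ⟨z, hy, rfl⟩
    · rintro ⟨z, hz, rfl⟩
      exact hz
  have hM : ∀ (Y : Finset (Fin n)) x, φ x ∈ Y.map φ.toEmbedding ↔ x ∈ Y := fun Y x => Finset.mem_map' φ.toEmbedding
  refine ⟨?_, ?_, ?_, ?_, ?_, ?_, ?_⟩
  · intro p hp
    obtain ⟨z, _, rfl⟩ := Finset.mem_map.1 hp
    exact ⟨z, rfl⟩
  · rintro _ ⟨x, rfl⟩ _ ⟨y, rfl⟩ hxy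
    rw [hP, hP]
    exact h.bip x y ((hadj _ _).1 hxy)
  · intro p hp
    obtain ⟨z, hz, rfl⟩ := Finset.mem_map.1 hp
    have := hn z
    rw [show φ.toEmbedding z = φ z from rfl, this]
    exact h.deg z hz
  · rintro _ ⟨x, rfl⟩
    rw [hn]; exact h.degge x
  · intro Z hZ hc
    obtain ⟨Z, rfl⟩ := pre Z (fun y hy => by
      obtain ⟨z, _, rfl⟩ := Finset.mem_map.1 (hZ hy)
      exact ⟨z, rfl⟩)
    rw [Finset.card_map] at hc
    obtain ⟨Z', a, b, d⟩ := h.up Z (Finset.map_subset_map.1 hZ) hc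
    refine ⟨Z'.map φ.toEmbedding, Finset.map_subset_map.2 a, b.map, ?_⟩
    intro p hp
    obtain ⟨p, hp0, rfl⟩ := Finset.mem_map.1 hp
    rintro _ ⟨q, rfl⟩ hpq
    obtain ⟨p', a, b, e⟩ := d p hp0 q ((hadj _ _).1 hpq)
    exact ⟨φ p', (hM _ _).2 a, fun h => b (hinj h), (hadj _ _).2 e⟩
  · intro Y hY hc
    obtain ⟨Y, rfl⟩ := pre Y (fun y hy => (hY y hy).1)
    rw [Finset.card_map] at hc
    obtain ⟨Z, a, b, m, r, d⟩ := h.low Y (fun y hy => by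
      rw [← hn]; exact (hY (φ y) ((hM _ _).2 hy)).2) (by
      refine hc.imp_right fun ⟨a, b, d⟩ => ⟨a, b, ?_⟩
      rintro ⟨w, hw⟩
      refine d ⟨φ w, ⟨w, rfl⟩, ?_⟩
      intro y hy
      obtain ⟨y, hy0, rfl⟩ := Finset.mem_map.1 hy
      exact (hadj _ _).2 (hw y hy0))
    refine ⟨Z.map φ.toEmbedding, Finset.map_subset_map.2 a, by rw [Finset.card_map, b],
      Function.extend φ (φ ∘ m) id, Function.extend φ r 0, ?_⟩
    intro p hp
    obtain ⟨p, hp0, rfl⟩ := Finset.mem_map.1 hp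
    rw [show φ.toEmbedding p = φ p from rfl, hinj.extend_apply, hinj.extend_apply]
    refine ⟨⟨_, rfl⟩, (hadj _ _).2 (d p hp0).1, fun h => (d p hp0).2.1 ((hM _ _).1 h), ?_⟩
    intro p' hp'
    obtain ⟨p', hp0', rfl⟩ := Finset.mem_map.1 hp'
    rw [show φ.toEmbedding p' = φ p' from rfl, hinj.extend_apply]
    intro hne ha
    exact (d p hp0).2.2 p' hp0' (fun h => hne (by rw [h])) ((hadj _ _).1 ha)
  · intro ht Y hY hc
    obtain ⟨Y, rfl⟩ := pre Y (fun y hy => (hY y hy).1)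
    rw [Finset.card_map] at hc
    rintro _ ⟨y, rfl⟩ hy
    rw [hM]
    exact h.all3 ht Y (fun y hy => by rw [← hn]; exact (hY (φ y) ((hM _ _).2 hy)).2) hc y (by rw [← hn]; exact hy)

theorem fbd_exists {W : Type} (G : SimpleGraph W) (F : Set W) (h : IsBlockBc _ (G.induce F)) :
    ∃ P c three, FBD G F P c three ∧ (¬ three → Nonempty (G.induce F ≃g BG2) ∨ Nonempty (G.induce F ≃g BG4)) := by
  have key : ∀ {n : ℕ} {B : SimpleGraph (Fin n)} {P c three}, BD B P c three → (e : G.induce F ≃g B) →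
      ∃ P', FBD G F P' c three := by
    intro n B P c three hb e
    have := hb.transport G (e.symm.toEmbedding.trans (Embedding.induce F))
    have hr : Set.range (e.symm.toEmbedding.trans (Embedding.induce (G := G) F)) = F := by
      ext x
      constructor
      · rintro ⟨y, rfl⟩
        exact (e.symm y).2
      · intro hx
        refine ⟨e ⟨x, hx⟩, ?_⟩
        change ((e.symm (e ⟨x, hx⟩) : F) : W) = x
        rw [RelIso.symm_apply_apply]
    rw [hr] at this
    exact ⟨_, this⟩
  rcases h with ⟨⟨e⟩⟩ | ⟨⟨e⟩⟩ | ⟨⟨e⟩⟩ | ⟨⟨e⟩⟩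
  · obtain ⟨P, h⟩ := key bd1 e
    exact ⟨P, _, _, h, by simp⟩
  · obtain ⟨P, h⟩ := key bd2 e
    exact ⟨P, _, _, h, fun _ => Or.inl ⟨e⟩⟩
  · obtain ⟨P, h⟩ := key bd3 e
    exact ⟨P, _, _, h, by simp⟩
  · obtain ⟨P, h⟩ := key bd4 e
    exact ⟨P, _, _, h, fun _ => Or.inr ⟨e⟩⟩


section

structure HP {W V : Type} (G : SimpleGraph W) (T : SimpleGraph V) (S D : Set V) (π : W → V)
    (P : V → Finset W) (c : V → ℕ) (th : V → Prop) : Prop where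
  tree : T.IsTree
  SD : ∀ v ∈ S, v ∈ D
  ind : ∀ u ∈ D, ∀ v ∈ D, ¬ T.Adj u v
  deg3 : ∀ v ∉ D, (T.neighborSet v).ncard = 3
  nb : ∀ v ∉ D, ∀ u, T.Adj v u → u ∈ D
  surj : Function.Surjective π
  single : ∀ w w', π w ∉ S → π w = π w' → w = w'
  e1 : ∀ w w', G.Adj w w' → (π w = π w' ∧ π w ∈ S) ∨ T.Adj (π w) (π w')
  e2 : ∀ w d, π w ∉ D → T.Adj (π w) d → ∃ q, π q = d ∧ G.Adj w q ∧ ∀ q', π q' = d → G.Adj w q' → q' = q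
  e3 : ∀ q w, π q ∈ S → π w ∉ D → G.Adj q w → (G.neighborSet q ∩ π ⁻¹' {π q}).ncard = 2
  e4 : ∀ q w w', π q ∈ S → G.Adj q w → G.Adj q w' → π w ≠ π q → π w' ≠ π q → w = w'
  fb : ∀ s ∈ S, FBD G (π ⁻¹' {s}) (P s) (c s) (th s)

theorem HP.exists {W V : Type} [Finite V] (G : SimpleGraph W)
    (T : SimpleGraph V) (S : Set V) (π : W → V)
    (hT : MemT T) (hS : S ⊆ gallaiD T)
    (hAr : ArisesFrom IsBlockBc G T S π) : ∃ P c th, HP G T S (gallaiD T) π P c th ∧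
      ∀ s ∈ S, ¬ th s → Nonempty (G.induce (π ⁻¹' {s}) ≃g BG2) ∨ Nonempty (G.induce (π ⁻¹' {s}) ≃g BG4) := by
  classical
  obtain ⟨h1, h2, h3, h4, h5, h6, h7, h8, h9⟩ := hAr
  obtain ⟨t1, t2, t3⟩ := tree_struct hT
  have : ∀ s, ∃ P c three, s ∈ S → FBD G (π ⁻¹' {s}) P c three ∧ (¬ three →
      Nonempty (G.induce (π ⁻¹' {s}) ≃g BG2) ∨ Nonempty (G.induce (π ⁻¹' {s}) ≃g BG4)) := by
    intro s
    by_cases hs : s ∈ S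
    · obtain ⟨P, c, t, h⟩ := fbd_exists G _ (h4 s hs)
      exact ⟨P, c, t, fun _ => h⟩
    · exact ⟨∅, 0, True, fun h => absurd h hs⟩
  choose P c th hfb using this
  refine ⟨P, c, th, ⟨hT.1, fun v hv => hS hv, t1, t2, t3, h1, ?_, ?_, ?_, ?_, ?_, fun s hs => (hfb s hs).1⟩,
    fun s hs => (hfb s hs).2⟩
  · intro w w' hw h
    exact h2 _ hw w w' rfl h.symm
  · intro w w' h
    by_cases hw : π w ∈ S <;> by_cases hw' : π w' ∈ S
    · left
      refine ⟨?_, hw⟩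
      by_contra hne
      exact h5 _ hw _ hw' hne w w' rfl rfl h
    · right
      by_contra hne
      exact h7 _ hw _ hw' hne w w' rfl rfl h
    · right
      by_contra hne
      exact h7 _ hw' _ hw (fun h => hne h.symm) w' w rfl rfl h.symm
    · right
      exact (h3 _ _ hw hw').1 h
  · intro w d hw hd
    have hwS : π w ∉ S := fun h => hw (hS h)
    by_cases hdS : d ∈ S
    · obtain ⟨⟨q, w'⟩, ⟨a1, a2, a3⟩, a4⟩ := h6 d hdS _ hwS hd.symm
      simp only at a1 a2 a3
      have : w' = w := h2 _ hwS _ _ a2 rfl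
      subst this
      refine ⟨q, a1, a3.symm, ?_⟩
      intro q' hq' ha
      exact congrArg Prod.fst (a4 (q', w') ⟨hq', rfl, ha.symm⟩)
    · obtain ⟨q, rfl⟩ := h1 d
      exact ⟨q, rfl, (h3 _ _ hwS hdS).2 hd, fun q' hq' _ => h2 _ hdS _ _ hq' rfl⟩
  · intro q w hq hw h
    exact h9 _ hq q rfl w (fun h' => hw (h' ▸ hS hq)) h
  · intro q w w' hq a b a' b'
    exact h8 _ hq q rfl w w' a' b' a b

variable {W V : Type} {G : SimpleGraph W} {T : SimpleGraph V} {S D : Set V} {π : W → V}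
    {P : V → Finset W} {c : V → ℕ} {th : V → Prop}

def PP (S D : Set V) (π : W → V) (P : V → Finset W) : Set W := {w | π w ∉ D ∨ (π w ∈ S ∧ w ∈ P (π w))}

theorem HP.notP (h : HP G T S D π P c th) {q w : W} (hq : π q ∈ S) (hw : π w ∉ D) (ha : G.Adj q w) :
    q ∉ P (π q) := fun hp => (h.fb _ hq).deg q hp (h.e3 q w hq hw ha)

theorem HP.bipG (h : HP G T S D π P c th) (x y : W) (hxy : G.Adj x y) :
    x ∈ PP S D π P ↔ y ∉ PP S D π P := by
  have key : ∀ x y, G.Adj x y → π x ∉ D → π y ∈ D → x ∈ PP S D π P ∧ y ∉ PP S D π P := by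
    intro x y hxy hx hy
    refine ⟨Or.inl hx, ?_⟩
    rintro (h' | ⟨h1, h2⟩)
    · exact h' hy
    · exact h.notP h1 hx hxy.symm h2
  rcases h.e1 x y hxy with ⟨he, hs⟩ | hT
  · have := (h.fb _ hs).bip x rfl y he.symm hxy
    have hd := h.SD _ hs
    simp only [PP, Set.mem_ofPred_eq, ← he, hs, hd, not_true, false_or, true_and]
    exact this
  · by_cases hx : π x ∈ D
    · have hy : π y ∉ D := fun hy => h.ind _ hx _ hy hT
      have := key y x hxy.symm hy hx
      tauto
    · have hy := h.nb _ hx _ hT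
      have := key x y hxy hx hy
      tauto

open Classical in
noncomputable def wt (S D : Set V) (c : V → ℕ) (v : V) : ℕ := if v ∈ D then (if v ∈ S then c v else 0) else 1

theorem HP.upper [Fintype W] [Fintype V] (h : HP G T S D π P c th) : nuUR G ≤ ∑ v, wt S D c v := by
  classical
  apply nuUR_le
  intro M hM
  have hcov : ∀ w, ∃ t, w ∈ covered M → s(w, t) ∈ M := by
    intro w
    by_cases hw : w ∈ covered M
    · obtain ⟨e, he, hwe⟩ := hw
      obtain ⟨t, rfl⟩ := Sym2.mem_iff_exists.1 hwe
      exact ⟨t, fun _ => he⟩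
    · exact ⟨w, fun h => absurd h hw⟩
  choose t ht using hcov
  set Q : Finset W := Finset.univ.filter (fun w => w ∈ PP S D π P ∧ w ∈ covered M) with hQ
  have hMQ : M.card ≤ Q.card := by
    apply Finset.card_le_card_of_surjOn (fun w => s(w, t w))
    intro e he
    have he : e ∈ M := he
    have key : ∀ a ∈ e, a ∈ PP S D π P → e ∈ (fun w => s(w, t w)) '' (Q : Set W) := by
      intro a hae ha
      have hc : a ∈ covered M := ⟨e, he, hae⟩
      refine ⟨a, by simp [hQ, ha, hc], ?_⟩
      exact hM.1.eq_of_mem (ht a hc) he (Sym2.mem_mk_left _ _) hae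
    induction e using Sym2.ind with
    | _ a b =>
      have hab : G.Adj a b := hM.1.1 _ he
      by_cases ha : a ∈ PP S D π P
      · exact key a (Sym2.mem_mk_left _ _) ha
      · refine key b (Sym2.mem_mk_right _ _) ?_
        by_contra hb
        exact ha ((h.bipG a b hab).2 hb)
  refine hMQ.trans ?_
  rw [Finset.card_eq_sum_card_fiberwise (f := π) (t := Finset.univ) (fun _ _ => Finset.mem_coe.2 (Finset.mem_univ _))]
  apply Finset.sum_le_sum
  intro v _
  unfold wt
  split_ifs with hD hS
  · by_contra hlt
    push Not at hlt
    have hsub : Q.filter (fun w => π w = v) ⊆ P v := by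
      intro w hw
      simp only [hQ, Finset.mem_filter, Finset.mem_univ, true_and] at hw
      obtain ⟨⟨h1, h2⟩, h3⟩ := hw
      rcases h1 with h1 | h1
      · exact absurd (h3 ▸ hD) h1
      · rw [← h3]; exact h1.2
    obtain ⟨Z', a, b, d⟩ := (h.fb v hS).up _ hsub hlt
    have hz : ∀ p ∈ Z', π p = v ∧ p ∈ P v ∧ p ∈ PP S D π P ∧ s(p, t p) ∈ M := by
      intro p hp
      have h0 := a hp
      have h1 := hsub h0
      simp only [hQ, Finset.mem_filter, Finset.mem_univ, true_and] at h0
      exact ⟨h0.2, h1, h0.1.1, ht p h0.1.2⟩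
    refine not_ur_of_stop G M hM Z' b t (fun p hp => (hz p hp).2.2.2) ?_ ?_
    · intro p hp hp'
      exact (h.bipG p (t p) (hM.1.1 _ (hz p hp).2.2.2)).1 (hz p hp).2.2.1 (hz _ hp').2.2.1
    · intro p hp
      obtain ⟨z1, z2, z3, z4⟩ := hz p hp
      have hadj : G.Adj p (t p) := hM.1.1 _ z4
      refine d p hp (t p) ?_ hadj
      rcases h.e1 _ _ hadj with h' | h'
      · exact h'.1.symm.trans z1
      · exfalso
        have hd : π (t p) ∉ D := fun hd => h.ind _ (z1 ▸ hD) _ hd h'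
        exact h.notP (z1 ▸ hS) hd hadj (z1 ▸ z2)
  · rw [Nat.le_zero, Finset.card_eq_zero, Finset.filter_eq_empty_iff]
    rintro w hw rfl
    simp only [hQ, Finset.mem_filter, Finset.mem_univ, true_and] at hw
    rcases hw.1 with h1 | h1
    · exact h1 hD
    · exact hS h1.1
  · rw [Finset.card_le_one]
    intro a ha b hb
    have ha := (Finset.mem_filter.1 ha).2
    have hb := (Finset.mem_filter.1 hb).2
    refine h.single a b ?_ (ha.trans hb.symm)
    rw [ha]; exact fun hs => hD (h.SD _ hs)

theorem ur_induce {α : Type*} [LinearOrder α] [WellFoundedLT α] [Finite W]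
    (X : Set W) (Pr : Set W) (hP : ∀ x y, G.Adj x y → (x ∈ Pr ↔ y ∉ Pr))
    (Z : Finset W) (m : W → W) (r : W → α) (hZ : ∀ p ∈ Z, p ∈ Pr)
    (hm : ∀ p ∈ Z, G.Adj p (m p)) (hZX : ∀ p ∈ Z, p ∉ X) (hmX : ∀ p ∈ Z, m p ∉ X)
    (hr : ∀ p ∈ Z, ∀ p' ∈ Z, p' ≠ p → G.Adj p' (m p) → r p' < r p) :
    Z.card ≤ nuUR (G.induce Xᶜ) := by
  classical
  obtain ⟨M, hM, hc⟩ := ur_of_rank (G.induce Xᶜ) {x | (x : W) ∈ Pr} (fun x y hxy => hP x y hxy)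
    (Z.subtype (· ∈ Xᶜ)) (fun p => if hp : m p ∈ Xᶜ then ⟨m p, hp⟩ else p) (fun p => r p)
    (fun p hp => hZ p (Finset.mem_subtype.1 hp))
    (fun p hp => by
      have hp := Finset.mem_subtype.1 hp
      rw [dif_pos (show m p ∈ Xᶜ from hmX p hp)]
      exact hm p hp)
    (fun p hp p' hp' hne hadj => by
      have hp := Finset.mem_subtype.1 hp
      have hp' := Finset.mem_subtype.1 hp'
      rw [dif_pos (show m p ∈ Xᶜ from hmX p hp)] at hadj
      exact hr p hp p' hp' (fun h => hne (Subtype.ext h)) hadj)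
  have : (Z.subtype (· ∈ Xᶜ)).card = Z.card := by
    rw [Finset.card_subtype, Finset.filter_true_of_mem]
    exact fun x hx => hZX x hx
  rw [← this, ← hc]
  exact le_nuUR hM


end

section

variable {W V : Type} {G : SimpleGraph W} {T : SimpleGraph V} {S D : Set V} {π : W → V}
    {P : V → Finset W} {c : V → ℕ} {th : V → Prop}

theorem HP.lower [Fintype W] [Fintype V] (h : HP G T S D π P c th) (X : Set W)
    (hXD : ∀ x ∈ X, π x ∈ D)
    (hXS : ∀ x ∈ X, π x ∈ S → (G.neighborSet x ∩ π ⁻¹' {π x}).ncard = 2 ∧ ∀ y, G.Adj x y → π y = π x)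
    (ρ : V) (sp : V → Prop) (ch : V → V)
    (hch : ∀ a ∉ D, T.Adj a (ch a) ∧ (T.dist ρ (ch a) = T.dist ρ a + 1 ∨ (sp a ∧ ch a = ρ)))
    (hspD : ∀ a, sp a → a ∉ D ∧ ch a = ρ)
    (hsp : ∀ a b, sp a → sp b → a = b)
    (hX1 : ∀ a ∉ D, ch a ∈ S ∨ ∀ x ∈ X, π x ≠ ch a)
    (hY : ∀ s ∈ S, ∃ Y : Finset W, (∀ y ∈ Y, π y = s ∧ (G.neighborSet y ∩ π ⁻¹' {s}).ncard = 2) ∧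
      (Y.card ≤ 2 ∨ (th s ∧ Y.card = 3 ∧ ¬ ∃ w, π w = s ∧ ∀ y ∈ Y, G.Adj w y)) ∧
      (∀ x ∈ X, π x = s → x ∈ Y) ∧
      (∀ a q, π a ∉ D → π q = s → G.Adj a q →
        (T.dist ρ s = T.dist ρ (π a) + 1 ∨ (sp (π a) ∧ s = ρ)) → q ∈ Y)) :
    ∑ v, wt S D c v ≤ nuUR (G.induce Xᶜ) := by
  classical
  have hblk : ∀ s, ∃ (Z : Finset W) (m : W → W) (r : W → ℕ), s ∈ S → Z ⊆ P s ∧ Z.card = c s ∧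
      ∀ p ∈ Z, π (m p) = s ∧ G.Adj p (m p) ∧ m p ∉ X ∧
      (∀ p' ∈ Z, p' ≠ p → G.Adj p' (m p) → r p' < r p) ∧
      (∀ a, π a ∉ D → G.Adj a (m p) → ¬ (T.dist ρ s = T.dist ρ (π a) + 1 ∨ (sp (π a) ∧ s = ρ))) := by
    intro s
    by_cases hs : s ∈ S
    · obtain ⟨Y, y1, y2, y3, y4⟩ := hY s hs
      obtain ⟨Z, z1, z2, m, r, z3⟩ := (h.fb s hs).low Y y1 y2
      refine ⟨Z, m, r, fun _ => ⟨z1, z2, fun p hp => ?_⟩⟩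
      obtain ⟨a1, a2, a3, a4⟩ := z3 p hp
      exact ⟨a1, a2, fun hx => a3 (y3 _ hx a1), a4, fun a ha hadj hh => a3 (y4 a _ ha a1 hadj hh)⟩
    · exact ⟨∅, id, 0, fun h => absurd h hs⟩
  choose Zs ms rs hblk using hblk
  have hatt : ∀ w, ∃ q, π w ∉ D → π q = ch (π w) ∧ G.Adj w q := by
    intro w
    by_cases hw : π w ∈ D
    · exact ⟨w, fun h => absurd hw h⟩
    · obtain ⟨q, q1, q2, _⟩ := h.e2 w _ hw (hch _ hw).1
      exact ⟨q, fun _ => ⟨q1, q2⟩⟩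
  choose att hatt using hatt
  obtain ⟨K, hK⟩ : ∃ K, ∀ v, T.dist ρ v ≤ K :=
    ⟨Finset.univ.sup (fun v => T.dist ρ v), fun v => Finset.le_sup (f := fun v => T.dist ρ v) (Finset.mem_univ v)⟩
  set Z : Finset W := Finset.univ.filter (fun w => π w ∉ D ∨ (π w ∈ S ∧ w ∈ Zs (π w))) with hZ
  have hZm : ∀ w, w ∈ Z ↔ π w ∉ D ∨ (π w ∈ S ∧ w ∈ Zs (π w)) := by intro w; simp [hZ]
  set m : W → W := fun w => if π w ∉ D then att w else ms (π w) w with hm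
  set R : V → ℕ := fun v => if sp v then K + 1 else K - T.dist ρ v with hR
  set r : W → ℕ ×ₗ ℕ := fun w => toLex (R (π w), if π w ∉ D then 0 else rs (π w) w) with hr
  have hRD : ∀ v ∈ D, R v = K - T.dist ρ v := by
    intro v hv
    simp only [hR]
    rw [if_neg]
    exact fun hs => (hspD v hs).1 hv
  have hRsp : ∀ v, sp v → R v = K + 1 := fun v hv => by simp only [hR]; rw [if_pos hv]
  have hRn : ∀ v, ¬ sp v → R v = K - T.dist ρ v := fun v hv => by simp only [hR]; rw [if_neg hv]
  have hRge : ∀ v, K - T.dist ρ v ≤ R v := by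
    intro v; simp only [hR]; split_ifs <;> omega
  have hlt : ∀ w w', R (π w') < R (π w) → r w' < r w := by
    intro w w' hh
    exact Prod.Lex.toLex_lt_toLex.2 (Or.inl hh)
  have hspdist : ∀ a, sp a → T.dist ρ a = 1 := by
    intro a ha
    obtain ⟨h1, h2⟩ := hspD a ha
    have := (hch a h1).1
    rw [h2] at this
    exact dist_eq_one_iff_adj.2 this.symm
  -- child of s has smaller rank
  have hchild : ∀ a d, a ∉ D → d ∈ D → T.Adj a d → T.dist ρ a = T.dist ρ d + 1 → ¬ (sp a ∧ d = ρ) →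
      R a < K - T.dist ρ d := by
    intro a d ha hd had hdist hns
    have hns' : ¬ sp a := by
      intro hs
      have := hspdist a hs
      have h0 : T.dist ρ d = 0 := by omega
      exact hns ⟨hs, ((h.tree.connected.dist_eq_zero_iff).1 h0).symm⟩
    rw [hRn a hns']
    have := hK a
    omega
  have hcard : ∑ v, wt S D c v ≤ Z.card := by
    rw [Finset.card_eq_sum_card_fiberwise (f := π) (t := Finset.univ) (fun _ _ => Finset.mem_coe.2 (Finset.mem_univ _))]
    apply Finset.sum_le_sum
    intro v _
    unfold wt
    split_ifs with hD hS
    · rw [← (hblk v hS).2.1]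
      apply Finset.card_le_card
      intro w hw
      have hw' : π w = v := (h.fb v hS).sub w ((hblk v hS).1 hw)
      rw [Finset.mem_filter, hZm, hw']
      exact ⟨Or.inr ⟨hS, hw⟩, rfl⟩
    · exact Nat.zero_le _
    · obtain ⟨w, rfl⟩ := h.surj v
      rw [Nat.one_le_iff_ne_zero, Finset.card_ne_zero]
      exact ⟨w, by rw [Finset.mem_filter, hZm]; exact ⟨Or.inl hD, rfl⟩⟩
  refine hcard.trans ?_
  refine ur_induce X (PP S D π P) h.bipG Z m r ?_ ?_ ?_ ?_ ?_
  · intro p hp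
    rcases (hZm p).1 hp with hp | ⟨hp1, hp2⟩
    · exact Or.inl hp
    · exact Or.inr ⟨hp1, (hblk _ hp1).1 hp2⟩
  · intro p hp
    rcases (hZm p).1 hp with hp | ⟨hp1, hp2⟩
    · simp only [hm]; rw [if_pos hp]; exact (hatt p hp).2
    · simp only [hm]; rw [if_neg (fun h' => h' (h.SD _ hp1))]
      exact ((hblk _ hp1).2.2 p hp2).2.1
  · intro p hp hpX
    rcases (hZm p).1 hp with hp | ⟨hp1, hp2⟩
    · exact hp (hXD p hpX)
    · exact (h.fb _ hp1).deg p ((hblk _ hp1).1 hp2) (hXS p hpX hp1).1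
  · intro p hp
    rcases (hZm p).1 hp with hp | ⟨hp1, hp2⟩
    · simp only [hm]; rw [if_pos hp]
      intro hx
      obtain ⟨q1, q2⟩ := hatt p hp
      rcases hX1 _ hp with h1 | h1
      · have := (hXS _ hx (q1 ▸ h1)).2 p q2.symm
        rw [this, q1] at hp
        exact hp (h.SD _ h1)
      · exact h1 _ hx q1
    · simp only [hm]; rw [if_neg (fun h' => h' (h.SD _ hp1))]
      exact ((hblk _ hp1).2.2 p hp2).2.2.1
  · intro p hp p' hp' hne hadj
    rcases (hZm p).1 hp with hp | ⟨hp1, hp2⟩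
    · simp only [hm] at hadj
      rw [if_pos hp] at hadj
      obtain ⟨q1, q2⟩ := hatt p hp
      obtain ⟨c1, c2⟩ := hch _ hp
      have hdD := h.nb _ hp _ c1
      apply hlt
      have hRd : R (ch (π p)) < R (π p) := by
        rw [hRD _ hdD]
        rcases c2 with c2 | ⟨c2, _⟩
        · have := hRge (π p)
          have := hK (ch (π p))
          omega
        · rw [hRsp _ c2]; omega
      rcases (hZm p').1 hp' with hp' | ⟨hp1', hp2'⟩
      · have hnπ : π p' ≠ π p := fun he => hne (h.single p' p (fun hs => hp' (h.SD _ hs)) he)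
        have hTa : T.Adj (π p') (ch (π p)) := by
          rcases h.e1 _ _ hadj with h' | h'
          · exact absurd (h.SD _ h'.2) hp'
          · rwa [q1] at h'
        by_cases hdS : ch (π p) ∈ S
        · exfalso
          refine hne (h.e4 (att p) p' p (q1 ▸ hdS) hadj.symm q2.symm ?_ ?_)
          · rw [q1]; exact fun he => hp' (he ▸ hdD)
          · rw [q1]; exact fun he => hp (by rw [he]; exact hdD)
        · rcases c2 with c2 | ⟨c2, c3⟩
          · refine lt_trans ?_ hRd
            rw [hRD _ hdD]
            apply hchild _ _ hp' hdD hTa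
            · rcases h.tree.dist_eq_dist_add_one_of_adj ρ hTa with h' | h'
              · exact h'
              · exact absurd (tree_parent h.tree ρ hTa.symm c1.symm h' c2) hnπ
            · rintro ⟨_, he⟩
              rw [he] at c2
              simp at c2
          · rw [hRsp _ c2, hRn _ (fun hs => hnπ (hsp _ _ hs c2))]
            omega
      · have : π p' = ch (π p) := by
          rcases h.e1 _ _ hadj with h' | h'
          · rw [h'.1, q1]
          · rw [q1] at h'
            exact absurd h' (h.ind _ (h.SD _ hp1') _ hdD)
        rw [this]; exact hRd
    · simp only [hm] at hadj
      have hpD := h.SD _ hp1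
      rw [if_neg (fun h' => h' hpD)] at hadj
      obtain ⟨a1, a2, a3, a4, a5⟩ := (hblk _ hp1).2.2 p hp2
      rcases (hZm p').1 hp' with hp' | ⟨hp1', hp2'⟩
      · apply hlt
        have hTa : T.Adj (π p') (π p) := by
          rcases h.e1 _ _ hadj with h' | h'
          · exact absurd (h.SD _ h'.2) hp'
          · rwa [a1] at h'
        have := a5 p' hp' hadj
        push Not at this
        rw [hRD _ hpD]
        apply hchild _ _ hp' hpD hTa
        · rcases h.tree.dist_eq_dist_add_one_of_adj ρ hTa with h' | h'
          · exact h'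
          · exact absurd h' this.1
        · exact fun hh => this.2 hh.1 hh.2
      · have he : π p' = π p := by
          rcases h.e1 _ _ hadj with h' | h'
          · rw [h'.1, a1]
          · rw [a1] at h'
            exact absurd h' (h.ind _ (h.SD _ hp1') _ hpD)
        have := a4 p' (he ▸ hp2') hne hadj
        simp only [hr]
        rw [he, if_neg (fun h' => h' hpD), if_neg (fun h' => h' hpD)]
        exact Prod.Lex.toLex_lt_toLex.2 (Or.inr ⟨rfl, this⟩)


end

section

variable {W V : Type} {G : SimpleGraph W} {T : SimpleGraph V} {S D : Set V} {π : W → V}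
    {P : V → Finset W} {c : V → ℕ} {th : V → Prop}

theorem HP.lower' [Fintype W] [Fintype V] (h : HP G T S D π P c th) (X : Set W)
    (hXD : ∀ x ∈ X, π x ∈ D)
    (hXS : ∀ x ∈ X, π x ∈ S → (G.neighborSet x ∩ π ⁻¹' {π x}).ncard = 2 ∧ ∀ y, G.Adj x y → π y = π x)
    (ρ : V) (sp : V → Prop) (ch : V → V)
    (hch : ∀ a ∉ D, T.Adj a (ch a) ∧ (T.dist ρ (ch a) = T.dist ρ a + 1 ∨ (sp a ∧ ch a = ρ)))
    (hspD : ∀ a, sp a → a ∉ D ∧ ch a = ρ)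
    (hsp : ∀ a b, sp a → sp b → a = b)
    (hX1 : ∀ a ∉ D, ch a ∈ S ∨ ∀ x ∈ X, π x ≠ ch a)
    (hY : ∀ s ∈ S, (X ∩ π ⁻¹' {s}).ncard ≤ 1 ∨ (s = ρ ∧ (∀ a, ¬ sp a) ∧ ((X ∩ π ⁻¹' {s}).ncard ≤ 2 ∨
      (th s ∧ (X ∩ π ⁻¹' {s}).ncard = 3 ∧ ¬ ∃ w, π w = s ∧ ∀ y ∈ X, π y = s → G.Adj w y)))) :
    ∑ v, wt S D c v ≤ nuUR (G.induce Xᶜ) := by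
  classical
  refine h.lower X hXD hXS ρ sp ch hch hspD hsp hX1 ?_
  intro s hs
  set Q : Finset W := Finset.univ.filter (fun q => ∃ a, π a ∉ D ∧ π q = s ∧ G.Adj a q ∧
        (T.dist ρ s = T.dist ρ (π a) + 1 ∨ (sp (π a) ∧ s = ρ))) with hQ
  set F : Finset W := Finset.univ.filter (fun x => x ∈ X ∧ π x = s) with hF
  have hQm : ∀ q, q ∈ Q ↔ ∃ a, π a ∉ D ∧ π q = s ∧ G.Adj a q ∧
        (T.dist ρ s = T.dist ρ (π a) + 1 ∨ (sp (π a) ∧ s = ρ)) := by intro q; simp [hQ]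
  have hFm : ∀ q, q ∈ F ↔ q ∈ X ∧ π q = s := by intro q; simp [hF]
  have hFc : (X ∩ π ⁻¹' {s}).ncard = F.card := by
    rw [← Set.ncard_coe_finset]
    congr 1
    ext x
    rw [Finset.mem_coe, hFm]
    rfl
  have hTa : ∀ a q, π a ∉ D → π q = s → G.Adj a q → T.Adj s (π a) := by
    intro a q ha hq haq
    rcases h.e1 _ _ haq with h' | h'
    · exact absurd (h.SD _ h'.2) ha
    · rw [hq] at h'; exact h'.symm
  have hQc : Q.card ≤ 1 := by
    rw [Finset.card_le_one]
    intro q hq q' hq'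
    obtain ⟨a, a1, a2, a3, a4⟩ := (hQm q).1 hq
    obtain ⟨b, b1, b2, b3, b4⟩ := (hQm q').1 hq'
    have hab : π a = π b := by
      rcases a4 with a4 | ⟨a4, a5⟩ <;> rcases b4 with b4 | ⟨b4, b5⟩
      · exact tree_parent h.tree ρ (hTa a q a1 a2 a3) (hTa b q' b1 b2 b3) a4 b4
      · rw [b5] at a4; simp at a4
      · rw [a5] at b4; simp at b4
      · exact hsp _ _ a4 b4
    have hab' := h.single a b (fun hh => a1 (h.SD _ hh)) hab
    subst hab'
    obtain ⟨q0, _, _, hu⟩ := h.e2 a s a1 (hTa a q a1 a2 a3).symm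
    rw [hu q a2 a3, hu q' b2 b3]
  refine ⟨F ∪ Q, ?_, ?_, ?_, ?_⟩
  · intro y hy
    rcases Finset.mem_union.1 hy with hy | hy
    · obtain ⟨y1, rfl⟩ := (hFm y).1 hy
      exact ⟨rfl, (hXS y y1 hs).1⟩
    · obtain ⟨a, a1, rfl, a3, a4⟩ := (hQm y).1 hy
      exact ⟨rfl, h.e3 y a hs a1 a3.symm⟩
  · have hu := Finset.card_union_le F Q
    rcases hY s hs with h1 | ⟨h1, h2, h3⟩
    · rw [hFc] at h1
      left; omega
    · have hQe : Q = ∅ := by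
        rw [Finset.eq_empty_iff_forall_notMem]
        intro q hq
        obtain ⟨a, a1, a2, a3, a4⟩ := (hQm q).1 hq
        rcases a4 with a4 | ⟨a4, a5⟩
        · rw [h1] at a4; simp at a4
        · exact h2 _ a4
      rw [hFc] at h3
      rw [hQe, Finset.union_empty]
      refine h3.imp_right fun ⟨b1, b2, b3⟩ => ⟨b1, b2, ?_⟩
      rintro ⟨w, w1, w2⟩
      exact b3 ⟨w, w1, fun y y1 y2 => w2 y ((hFm y).2 ⟨y1, y2⟩)⟩
  · intro x hx hxs
    exact Finset.mem_union_left _ ((hFm x).2 ⟨hx, hxs⟩)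
  · intro a q a1 a2 a3 a4
    exact Finset.mem_union_right _ ((hQm q).2 ⟨a, a1, a2, a3, a4⟩)

theorem HP.children (h : HP G T S D π P c th) (ρ a : V) (ha : a ∉ D) :
    ∃ d1 d2, d1 ≠ d2 ∧ T.Adj a d1 ∧ T.Adj a d2 ∧ T.dist ρ d1 = T.dist ρ a + 1 ∧ T.dist ρ d2 = T.dist ρ a + 1 := by
  obtain ⟨x, y, z, hxy, hxz, hyz, he⟩ := Set.ncard_eq_three.1 (h.deg3 a ha)
  have hx : T.Adj a x := by rw [← mem_neighborSet, he]; simp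
  have hy : T.Adj a y := by rw [← mem_neighborSet, he]; simp
  have hz : T.Adj a z := by rw [← mem_neighborSet, he]; simp
  have key : ∀ u, T.Adj a u → T.dist ρ a = T.dist ρ u + 1 ∨ T.dist ρ u = T.dist ρ a + 1 :=
    fun u hu => h.tree.dist_eq_dist_add_one_of_adj ρ hu
  rcases key x hx with h1 | h1
  · rcases key y hy with h2 | h2
    · exact absurd (tree_parent h.tree ρ hx hy h1 h2) hxy
    · rcases key z hz with h3 | h3
      · exact absurd (tree_parent h.tree ρ hx hz h1 h3) hxz
      · exact ⟨y, z, hyz, hy, hz, h2, h3⟩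
  · rcases key y hy with h2 | h2
    · rcases key z hz with h3 | h3
      · exact absurd (tree_parent h.tree ρ hy hz h2 h3) hyz
      · exact ⟨x, z, hxz, hx, hz, h1, h3⟩
    · exact ⟨x, y, hxy, hx, hy, h1, h2⟩

theorem HP.lower_plain [Fintype W] [Fintype V] (h : HP G T S D π P c th) (X : Set W)
    (hXD : ∀ x ∈ X, π x ∈ D)
    (hXS : ∀ x ∈ X, π x ∈ S → (G.neighborSet x ∩ π ⁻¹' {π x}).ncard = 2 ∧ ∀ y, G.Adj x y → π y = π x)
    (ρ : V)
    (hc : ∀ a ∉ D, ∀ d1 d2, d1 ≠ d2 → T.Adj a d1 → T.Adj a d2 → T.dist ρ d1 = T.dist ρ a + 1 →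
      T.dist ρ d2 = T.dist ρ a + 1 → d1 ∈ π '' X → d2 ∈ π '' X → False)
    (hY : ∀ s ∈ S, (X ∩ π ⁻¹' {s}).ncard ≤ 1 ∨ (s = ρ ∧ ((X ∩ π ⁻¹' {s}).ncard ≤ 2 ∨
      (th s ∧ (X ∩ π ⁻¹' {s}).ncard = 3 ∧ ¬ ∃ w, π w = s ∧ ∀ y ∈ X, π y = s → G.Adj w y)))) :
    ∑ v, wt S D c v ≤ nuUR (G.induce Xᶜ) := by
  classical
  have hch : ∀ a, ∃ d, a ∉ D → T.Adj a d ∧ T.dist ρ d = T.dist ρ a + 1 ∧ ∀ x ∈ X, π x ≠ d := by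
    intro a
    by_cases ha : a ∈ D
    · exact ⟨a, fun h => absurd ha h⟩
    · obtain ⟨d1, d2, x1, x2, x3, x4, x5⟩ := h.children ρ a ha
      by_cases h1 : d1 ∈ π '' X
      · exact ⟨d2, fun _ => ⟨x3, x5, fun x hx he => hc a ha d1 d2 x1 x2 x3 x4 x5 h1 ⟨x, hx, he⟩⟩⟩
      · exact ⟨d1, fun _ => ⟨x2, x4, fun x hx he => h1 ⟨x, hx, he⟩⟩⟩
  choose ch hch using hch
  refine h.lower' X hXD hXS ρ (fun _ => False) ch (fun a ha => ⟨(hch a ha).1, Or.inl (hch a ha).2.1⟩)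
    (fun a ha => ha.elim) (fun a _ ha => ha.elim) (fun a ha => Or.inr (hch a ha).2.2) ?_
  intro s hs
  exact (hY s hs).imp_right fun ⟨a, b⟩ => ⟨a, fun _ => id, b⟩

theorem HP.lower_sp [Fintype W] [Fintype V] (h : HP G T S D π P c th) (X : Set W)
    (hXD : ∀ x ∈ X, π x ∈ D)
    (hXS : ∀ x ∈ X, π x ∈ S → (G.neighborSet x ∩ π ⁻¹' {π x}).ncard = 2 ∧ ∀ y, G.Adj x y → π y = π x)
    (ρ a0 : V) (ha0 : a0 ∉ D) (ha0ρ : T.Adj a0 ρ) (hρ : ρ ∈ S ∨ ∀ x ∈ X, π x ≠ ρ)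
    (hc : ∀ a ∉ D, a ≠ a0 → ∀ d1 d2, d1 ≠ d2 → T.Adj a d1 → T.Adj a d2 → T.dist ρ d1 = T.dist ρ a + 1 →
      T.dist ρ d2 = T.dist ρ a + 1 → d1 ∈ π '' X → d2 ∈ π '' X → False)
    (hY : ∀ s ∈ S, (X ∩ π ⁻¹' {s}).ncard ≤ 1) :
    ∑ v, wt S D c v ≤ nuUR (G.induce Xᶜ) := by
  classical
  have hch : ∀ a, ∃ d, a ∉ D → a ≠ a0 → T.Adj a d ∧ T.dist ρ d = T.dist ρ a + 1 ∧ ∀ x ∈ X, π x ≠ d := by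
    intro a
    by_cases ha : a ∉ D ∧ a ≠ a0
    · obtain ⟨d1, d2, x1, x2, x3, x4, x5⟩ := h.children ρ a ha.1
      by_cases h1 : d1 ∈ π '' X
      · exact ⟨d2, fun _ _ => ⟨x3, x5, fun x hx he => hc a ha.1 ha.2 d1 d2 x1 x2 x3 x4 x5 h1 ⟨x, hx, he⟩⟩⟩
      · exact ⟨d1, fun _ _ => ⟨x2, x4, fun x hx he => h1 ⟨x, hx, he⟩⟩⟩
    · exact ⟨a, fun h h' => absurd ⟨h, h'⟩ ha⟩
  choose ch hch using hch
  refine h.lower' X hXD hXS ρ (fun a => a = a0) (fun a => if a = a0 then ρ else ch a) ?_ ?_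
    (fun a b ha hb => ha.trans hb.symm) ?_ (fun s hs => Or.inl (hY s hs))
  · intro a ha
    by_cases h0 : a = a0
    · simp only [h0, if_true]
      exact ⟨ha0ρ, Or.inr ⟨trivial, trivial⟩⟩
    · simp only [h0, if_false]
      exact ⟨(hch a ha h0).1, Or.inl (hch a ha h0).2.1⟩
  · rintro a rfl
    exact ⟨ha0, if_pos rfl⟩
  · intro a ha
    by_cases h0 : a = a0
    · simp only [h0, if_true]; exact hρ
    · simp only [h0, if_false]; exact Or.inr (hch a ha h0).2.2

theorem HP.main [Fintype W] [Fintype V] (h : HP G T S D π P c th)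
    (hth : ∀ s ∈ S, ¬ th s → (∀ w, π w = s) → False)
    (X : Set W) (hX : X ⊆ {w : W | π w ∈ D ∧ π w ∉ S} ∪ {w : W | (G.neighborSet w).ncard = 2})
    (hcard : X.ncard = 3)
    (hno3 : ∀ w ∉ X, (G.neighborSet w ∩ X).ncard < 3) :
    ∑ v, wt S D c v ≤ nuUR (G.induce Xᶜ) := by
  classical
  have hXD : ∀ x ∈ X, π x ∈ D := by
    intro x hx
    rcases hX hx with h1 | h1
    · exact h1.1
    · by_contra hd
      have h3 := h.deg3 _ hd
      have hsub : T.neighborSet (π x) ⊆ π '' G.neighborSet x := by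
        intro d hxd
        obtain ⟨q, q1, q2, _⟩ := h.e2 x d hd hxd
        exact ⟨q, q2, q1⟩
      have h4 := Set.ncard_le_ncard hsub (Set.toFinite _)
      have h5 := Set.ncard_image_le (f := π) (Set.toFinite (G.neighborSet x))
      have h6 : (G.neighborSet x).ncard = 2 := h1
      omega
  have hXS : ∀ x ∈ X, π x ∈ S → (G.neighborSet x ∩ π ⁻¹' {π x}).ncard = 2 ∧ ∀ y, G.Adj x y → π y = π x := by
    intro x hx hs
    rcases hX hx with h1 | h1
    · exact absurd hs h1.2
    · have h6 : (G.neighborSet x).ncard = 2 := h1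
      have h7 := (h.fb _ hs).degge x rfl
      have h8 : G.neighborSet x ∩ π ⁻¹' {π x} = G.neighborSet x :=
        Set.eq_of_subset_of_ncard_le Set.inter_subset_left (by omega) (Set.toFinite _)
      refine ⟨by rw [h8, h6], fun y hy => ?_⟩
      have : y ∈ G.neighborSet x ∩ π ⁻¹' {π x} := by rw [h8]; exact hy
      exact this.2
  have hXf : X.Finite := Set.toFinite _
  by_cases hbig : ∃ s, 2 ≤ (X ∩ π ⁻¹' {s}).ncard
  · obtain ⟨s, hs2⟩ := hbig
    have hsS : s ∈ S := by
      by_contra hsS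
      have : (X ∩ π ⁻¹' {s}).ncard ≤ 1 := by
        rw [Set.ncard_le_one (Set.toFinite _)]
        rintro a ⟨_, ha⟩ b ⟨_, hb⟩
        have ha : π a = s := ha
        have hb : π b = s := hb
        exact h.single a b (ha ▸ hsS) (ha.trans hb.symm)
      omega
    have hrest : ∀ U ⊆ X, (∀ x ∈ U, π x ≠ s) → U.ncard ≤ 1 := by
      intro U hU hUs
      have hdisj : Disjoint U (X ∩ π ⁻¹' {s}) := by
        rw [Set.disjoint_left]
        intro x hx hx'
        exact hUs x hx hx'.2
      have h1 := Set.ncard_union_eq hdisj (Set.toFinite _) (Set.toFinite _)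
      have h2 := Set.ncard_le_ncard (Set.union_subset hU (Set.inter_subset_left (s := X) (t := π ⁻¹' {s}))) hXf
      omega
    refine h.lower_plain X hXD hXS s ?_ ?_
    · rintro a ha d1 d2 hne h1 h2 e1 e2 ⟨x1, hx1, rfl⟩ ⟨x2, hx2, rfl⟩
      have := hrest {x1, x2} (by rintro x (rfl | rfl) <;> assumption) (by
        rintro x (rfl | rfl) he
        · rw [he] at e1; simp at e1
        · rw [he] at e2; simp at e2)
      rw [Set.ncard_pair (fun he => hne (by rw [he]))] at this
      omega
    · intro s' hs'
      by_cases he : s' = s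
      · right
        subst he
        refine ⟨rfl, ?_⟩
        by_cases h2 : (X ∩ π ⁻¹' {s'}).ncard ≤ 2
        · exact Or.inl h2
        · right
          have hle := Set.ncard_le_ncard (Set.inter_subset_left (s := X) (t := π ⁻¹' {s'})) hXf
          have h3 : (X ∩ π ⁻¹' {s'}).ncard = 3 := by omega
          have hXe : X ∩ π ⁻¹' {s'} = X := Set.eq_of_subset_of_ncard_le Set.inter_subset_left (by omega) hXf
          have hXin : ∀ x ∈ X, π x = s' := fun x hx => by
            have : x ∈ X ∩ π ⁻¹' {s'} := by rw [hXe]; exact hx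
            exact this.2
          refine ⟨?_, h3, ?_⟩
          · by_contra hnt
            apply hth s' hsS hnt
            intro w
            by_contra hw
            obtain ⟨p⟩ := h.tree.connected.preconnected s' (π w)
            cases p with
            | nil => exact hw rfl
            | @cons _ a _ hadj _ =>
              have haD : a ∉ D := fun hd => h.ind _ (h.SD _ hsS) _ hd hadj
              obtain ⟨u, rfl⟩ := h.surj a
              obtain ⟨q, q1, q2, _⟩ := h.e2 u s' haD hadj.symm
              have q3 := h.e3 q u (q1 ▸ hsS) haD q2.symm
              rw [q1] at q3
              have hq := (h.fb s' hsS).all3 hnt hXf.toFinset (fun y hy => by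
                have hy := hXf.mem_toFinset.1 hy
                have hys := hXin y hy
                refine ⟨hys, ?_⟩
                have := (hXS y hy (hys ▸ hsS)).1
                rwa [hys] at this) (by rw [← Set.ncard_eq_toFinset_card, hcard]) q q1 q3
              have hq := hXf.mem_toFinset.1 hq
              have := (hXS q hq (q1 ▸ hsS)).2 u q2.symm
              rw [q1] at this
              exact haD (this ▸ h.SD _ hsS)
          · rintro ⟨w, w1, w2⟩
            have hwX : w ∉ X := fun hw => G.loopless.irrefl _ (w2 w hw w1)
            have := hno3 w hwX
            rw [Set.inter_eq_right.2 (show X ⊆ G.neighborSet w from fun x hx => w2 x hx (hXin x hx)), hcard] at this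
            omega
      · left
        exact hrest _ Set.inter_subset_left (fun x hx hxs => he (hx.2.symm.trans hxs))
  · push Not at hbig
    have hY : ∀ s, (X ∩ π ⁻¹' {s}).ncard ≤ 1 := fun s => by have := hbig s; omega
    by_cases h2 : ∃ a0, a0 ∉ D ∧ ∃ e1 e2, e1 ≠ e2 ∧ T.Adj a0 e1 ∧ T.Adj a0 e2 ∧ e1 ∈ π '' X ∧ e2 ∈ π '' X
    · obtain ⟨a0, ha0, e1, e2, hne, he1, he2, hx1, hx2⟩ := h2
      have hρ : ∃ ρ, T.Adj a0 ρ ∧ (ρ ∈ S ∨ ∀ x ∈ X, π x ≠ ρ) := by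
        by_contra hcon
        push Not at hcon
        obtain ⟨w, rfl⟩ := h.surj a0
        have hwX : w ∉ X := fun hw => ha0 (hXD w hw)
        have hlt := hno3 w hwX
        have hsub : T.neighborSet (π w) ⊆ π '' (G.neighborSet w ∩ X) := by
          intro d hd
          obtain ⟨hdS, x, hx, rfl⟩ := hcon d hd
          obtain ⟨q, q1, q2, _⟩ := h.e2 w _ ha0 hd
          have : q = x := h.single q x (q1 ▸ hdS) q1
          subst this
          exact ⟨q, ⟨q2, hx⟩, rfl⟩
        have h4 := Set.ncard_le_ncard hsub (Set.toFinite _)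
        have h5 := Set.ncard_image_le (f := π) (Set.toFinite (G.neighborSet w ∩ X))
        rw [h.deg3 _ ha0] at h4
        omega
      obtain ⟨ρ, hadj, hρ⟩ := hρ
      refine h.lower_sp X hXD hXS ρ a0 ha0 hadj hρ ?_ (fun s _ => hY s)
      intro a ha hne0 d1 d2 hd a1 a2 k1 k2 m1 m2
      have key : ∀ e, T.Adj a0 e → T.Adj a e → T.dist ρ e = T.dist ρ a + 1 → False := by
        intro e he hae hde
        rcases h.tree.dist_eq_dist_add_one_of_adj ρ he with h' | h'
        · have := dist_eq_one_iff_adj.2 hadj.symm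
          omega
        · exact hne0 (tree_parent h.tree ρ hae.symm he.symm hde h')
      have hsub : (({d1, d2, e1, e2} : Finset V) : Set V) ⊆ π '' X := by
        intro v hv
        simp only [Finset.coe_insert, Finset.coe_singleton, Set.mem_insert_iff, Set.mem_singleton_iff] at hv
        rcases hv with rfl | rfl | rfl | rfl <;> assumption
      have h4 := Set.ncard_le_ncard hsub (Set.toFinite _)
      have h5 := Set.ncard_image_le (f := π) hXf
      rw [Set.ncard_coe_finset] at h4
      have n1 : d1 ≠ e1 := fun he => key d1 (he ▸ he1) a1 k1
      have n2 : d1 ≠ e2 := fun he => key d1 (he ▸ he2) a1 k1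
      have n3 : d2 ≠ e1 := fun he => key d2 (he ▸ he1) a2 k2
      have n4 : d2 ≠ e2 := fun he => key d2 (he ▸ he2) a2 k2
      have h6 : ({d1, d2, e1, e2} : Finset V).card = 4 := by
        simp [Finset.card_insert_of_notMem, *]
      omega
    · obtain ⟨x, hx⟩ : X.Nonempty := by
        rw [← Set.ncard_pos hXf]; omega
      refine h.lower_plain X hXD hXS (π x) ?_ (fun s _ => Or.inl (hY s))
      intro a ha d1 d2 hd a1 a2 _ _ m1 m2
      exact h2 ⟨a, ha, d1, d2, hd, a1, a2, m1, m2⟩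


end

theorem statement16 {W V : Type} [Fintype W] [Finite V] (G : SimpleGraph W)
    (T : SimpleGraph V) (S : Set V) (π : W → V)
    (hT : MemT T) (hS : S ⊆ gallaiD T)
    (hAr : ArisesFrom IsBlockBc G T S π)
    (hG2 : ¬ Nonempty (G ≃g BG2)) (hG4 : ¬ Nonempty (G ≃g BG4))
    (X : Set W)
    (hX : X ⊆ {w : W | π w ∈ gallaiD T ∧ π w ∉ S} ∪
      {w : W | (G.neighborSet w).ncard = 2})
    (hcard : X.ncard = 3)
    (hno3 : ∀ w ∉ X, (G.neighborSet w ∩ X).ncard < 3) :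
    nuUR (G.induce Xᶜ) = nuUR G := by
  classical
  haveI : Fintype V := Fintype.ofFinite V
  obtain ⟨P, c, th, h, hiso⟩ := HP.exists G T S π hT hS hAr
  apply le_antisymm
  · exact nuUR_mono _ _ (Embedding.induce _)
  · refine h.upper.trans (h.main ?_ X hX hcard hno3)
    intro s hs hn hall
    have hu : π ⁻¹' {s} = Set.univ := by
      ext w; simp [hall w]
    have hi := hiso s hs hn
    rw [hu] at hi
    rcases hi with ⟨⟨e⟩⟩ | ⟨⟨e⟩⟩
    · exact hG2 ⟨(induceUnivIso G).symm.trans e⟩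
    · exact hG4 ⟨(induceUnivIso G).symm.trans e⟩


end URPaper
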